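/- arXiv:2507.10116 — 3 statements merged into one kernel-verified Lean document; each statement's English description precedes it below -/
import Mathlib

section
/- (Schur–Wielandt, second part.) Let G be a finite abelian group of order n and let 𝒮 be an S-ring partition over G. Let p be a prime dividing n and set H = {g ∈ G : g^p = 1}. Then for every 𝒮-set X (i.e., every union of classes of 𝒮), the set X^[p] = {x^p : x ∈ X and |xH ∩ X| is not divisible by p} is again an 𝒮-set. -/
/-- An S-ring partition over a group `G`: a partition of `G` containing `{1}`,
closed under taking inverses, and with well-defined structure constants. -/
def IsSRing {G : Type*} [Group G] (S : Set (Set G)) : Prop :=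
  Setoid.IsPartition S ∧
  {(1 : G)} ∈ S ∧
  (∀ X ∈ S, (fun x : G => x⁻¹) '' X ∈ S) ∧
  (∀ X ∈ S, ∀ Y ∈ S, ∀ Z ∈ S, ∀ z ∈ Z, ∀ z' ∈ Z,
    {p : G × G | p.1 ∈ X ∧ p.2 ∈ Y ∧ p.1 * p.2 = z}.ncard =
    {p : G × G | p.1 ∈ X ∧ p.2 ∈ Y ∧ p.1 * p.2 = z'}.ncard)

/-- An `S`-set: a union of classes of the partition `S`. -/
def IsSSet {G : Type*} (S : Set (Set G)) (X : Set G) : Prop :=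
  ∃ T ⊆ S, X = ⋃₀ T

open Classical in
/-- Functions constant on the classes of an S-ring are closed under convolution. -/
theorem srConst_mul {G R : Type*} [CommGroup G] [Fintype G] [CommRing R]
    (S : Set (Set G)) (hS : IsSRing S) (f g : MonoidAlgebra R G)
    (hf : ∀ C ∈ S, ∀ z ∈ C, ∀ z' ∈ C, f.coeff z = f.coeff z')
    (hg : ∀ C ∈ S, ∀ z ∈ C, ∀ z' ∈ C, g.coeff z = g.coeff z') :
    ∀ C ∈ S, ∀ z ∈ C, ∀ z' ∈ C, (f * g).coeff z = (f * g).coeff z' := by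
  obtain ⟨⟨-, hpart⟩, -, -, hmul⟩ := hS
  choose cl hcl hcu using hpart
  simp only at hcl hcu
  have hiff : ∀ a, ∀ C ∈ S, (cl a = C ↔ a ∈ C) := by
    intro a C hC
    constructor
    · rintro rfl
      exact (hcl a).2
    · intro h
      exact (hcu a C ⟨hC, h⟩).symm
  have key : ∀ f : MonoidAlgebra R G,
      (∀ C ∈ S, ∀ z ∈ C, ∀ z' ∈ C, f.coeff z = f.coeff z') →
      ∃ F : Set G → R, ∀ a, f.coeff a = F (cl a) := by
    intro f hf
    refine ⟨fun C => if h : C.Nonempty then f.coeff h.some else 0, fun a => ?_⟩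
    have h : (cl a).Nonempty := ⟨a, (hcl a).2⟩
    simp only [h, dif_pos]
    exact hf _ (hcl a).1 _ (hcl a).2 _ h.some_mem
  obtain ⟨F, hF⟩ := key f hf
  obtain ⟨K, hK⟩ := key g hg
  have expand : ∀ z, (f * g).coeff z = ∑ j : Set G × Set G,
      (({q : G × G | q.1 * q.2 = z} : Finset (G × G)).filter
        (fun q => (cl q.1, cl q.2) = j)).card • (F j.1 * K j.2) := by
    intro z
    rw [MonoidAlgebra.coeff_mul_antidiag f g z ({q : G × G | q.1 * q.2 = z} : Finset (G × G))
      (by simp)]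
    simp only [hF, hK]
    rw [← Finset.sum_fiberwise' _ (fun q : G × G => (cl q.1, cl q.2))
      (fun j : Set G × Set G => F j.1 * K j.2)]
    simp only [Finset.sum_const]
  intro C hC z hz z' hz'
  rw [expand, expand]
  refine Finset.sum_congr rfl fun j _ => ?_
  congr 1
  obtain ⟨A, B⟩ := j
  by_cases hA : A ∈ S
  · by_cases hB : B ∈ S
    · have := hmul A hA B hB C hC z hz z' hz'
      have conv : ∀ z, (({q : G × G | q.1 * q.2 = z} : Finset (G × G)).filter
          (fun q => (cl q.1, cl q.2) = (A, B))).card =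
          {q : G × G | q.1 ∈ A ∧ q.2 ∈ B ∧ q.1 * q.2 = z}.ncard := by
        intro z
        rw [← Set.ncard_coe_finset]
        congr 1
        ext q
        simp only [Finset.coe_filter, Finset.mem_filter, Finset.mem_univ, true_and,
          Prod.mk.injEq, hiff _ A hA, hiff _ B hB, Set.mem_setOf_eq]
        tauto
      rw [conv, conv, this]
    · rw [Finset.filter_eq_empty_iff.2, Finset.filter_eq_empty_iff.2]
      all_goals
        rintro q - h
        exact hB ((Prod.mk.inj h).2 ▸ (hcl q.2).1)
  · rw [Finset.filter_eq_empty_iff.2, Finset.filter_eq_empty_iff.2]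
    all_goals
      rintro q - h
      exact hA ((Prod.mk.inj h).1 ▸ (hcl q.1).1)

/-- Schur–Wielandt, second part: for an S-ring over a finite
abelian group of order `n`, a prime `p ∣ n`, and `H = {g : g^p = 1}`, the set
`X^[p] = {x^p : x ∈ X, |xH ∩ X| ≢ 0 (mod p)}` is an `S`-set whenever `X` is. -/
theorem schur_wielandt_p_power {G : Type*} [CommGroup G] [Fintype G]
    (S : Set (Set G)) (hS : IsSRing S)
    (p : ℕ) (hp : p.Prime) (hdvd : p ∣ Fintype.card G)
    (X : Set G) (hX : IsSSet S X) :
    IsSSet S {y : G | ∃ x ∈ X,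
      ¬ (p ∣ ({z ∈ X | (x⁻¹ * z) ^ p = 1}).ncard) ∧ y = x ^ p} := by
  classical
  haveI : Fact p.Prime := ⟨hp⟩
  haveI : CharP (MonoidAlgebra (ZMod p) G) p :=
    charP_of_injective_algebraMap (algebraMap (ZMod p) (MonoidAlgebra (ZMod p) G)).injective p
  obtain ⟨T, hTS, rfl⟩ := hX
  set X := ⋃₀ T with hXdef
  have hXC : ∀ C ∈ S, ∀ z ∈ C, ∀ z' ∈ C, z ∈ X → z' ∈ X := by
    rintro C hC z hz z' hz' ⟨D, hD, hzD⟩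
    have : D = C := (hS.1.2 z).unique ⟨hTS hD, hzD⟩ ⟨hC, hz⟩
    exact ⟨D, hD, this ▸ hz'⟩
  let a : MonoidAlgebra (ZMod p) G := ∑ x ∈ X.toFinset, MonoidAlgebra.single x 1
  have ha : ∀ C ∈ S, ∀ z ∈ C, ∀ z' ∈ C, a.coeff z = a.coeff z' := by
    intro C hC z hz z' hz'
    have h : z ∈ X ↔ z' ∈ X := ⟨hXC C hC z hz z' hz', hXC C hC z' hz' z hz⟩
    simp [a, MonoidAlgebra.coeff_sum, Finsupp.single_apply, h]
  have hpow : ∀ k, ∀ C ∈ S, ∀ z ∈ C, ∀ z' ∈ C, (a ^ (k + 1)).coeff z = (a ^ (k + 1)).coeff z' := by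
    intro k
    induction k with
    | zero => simpa using ha
    | succ k ih =>
      rw [pow_succ]
      exact srConst_mul S hS _ _ ih ha
  have hap : ∀ y, (a ^ p).coeff y = (({z ∈ X | z ^ p = y} : Set G).ncard : ZMod p) := by
    intro y
    have : ({z ∈ X | z ^ p = y} : Set G) = ((X.toFinset.filter (fun z => z ^ p = y) : Finset G) : Set G) := by
      ext; simp
    rw [this, Set.ncard_coe_finset]
    simp [a, sum_pow_char, MonoidAlgebra.coeff_sum, Finsupp.single_apply, MonoidAlgebra.single_pow]
  have hset : {y : G | ∃ x ∈ X, ¬ (p ∣ ({z ∈ X | (x⁻¹ * z) ^ p = 1}).ncard) ∧ y = x ^ p}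
      = {y | (a ^ p).coeff y ≠ 0} := by
    have e : ∀ x : G, ({z ∈ X | (x⁻¹ * z) ^ p = 1} : Set G) = {z ∈ X | z ^ p = x ^ p} := by
      intro x
      ext z
      simp only [Set.mem_setOf_eq, mul_pow, inv_pow, inv_mul_eq_one, eq_comm]
    ext y
    simp only [Set.mem_setOf_eq, hap, e, ne_eq, ZMod.natCast_eq_zero_iff]
    constructor
    · rintro ⟨x, hx, h, rfl⟩
      exact h
    · intro h
      have hne : ({z ∈ X | z ^ p = y} : Set G).Nonempty := by
        by_contra h0
        rw [Set.not_nonempty_iff_eq_empty.1 h0] at h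
        simp at h
      obtain ⟨x, hx, rfl⟩ := hne
      exact ⟨x, hx, h, rfl⟩
  rw [hset]
  have hpp := hpow (p - 1)
  rw [Nat.sub_add_cancel hp.one_le] at hpp
  refine ⟨{C ∈ S | ∀ y ∈ C, (a ^ p).coeff y ≠ 0}, fun C h => h.1, ?_⟩
  ext y
  constructor
  · intro hy
    obtain ⟨C, ⟨hC, hyC⟩, -⟩ := hS.1.2 y
    exact ⟨C, ⟨hC, fun y' hy' => hpp C hC y hyC y' hy' ▸ hy⟩, hyC⟩
  · rintro ⟨C, ⟨hC, h⟩, hyC⟩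
    exact h y hyC
end

section
/- Let G be a finite cyclic group of odd order and let 𝒮 be a normal S-ring partition over G (the group of right translations is a normal subgroup of Aut(𝒮)). Then there exists a unique subgroup M of the automorphism group Aut(G) of the group G such that the classes of 𝒮 are exactly the orbits of M on G; moreover, Aut(𝒮) = {x ↦ σ(x)·g : σ ∈ M, g ∈ G}, i.e., Aut(𝒮) is the semidirect product of the right translations by M. -/
/-- An automorphism of the S-ring `S`: a permutation `f` of `G` such that
for all `x, y` and all `X ∈ S`, `y·x⁻¹ ∈ X` iff `f(y)·f(x)⁻¹ ∈ X`. -/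
def IsSRingAut {G : Type*} [Group G] (S : Set (Set G)) (f : Equiv.Perm G) : Prop :=
  ∀ X ∈ S, ∀ x y : G, (y * x⁻¹ ∈ X ↔ f y * (f x)⁻¹ ∈ X)

/-- The S-ring `S` is normal: the group of right translations is a normal
subgroup of `Aut(S)`, i.e. every automorphism of `S` conjugates each right
translation to a right translation. -/
def IsNormalSRing {G : Type*} [Group G] (S : Set (Set G)) : Prop :=
  ∀ f : Equiv.Perm G, IsSRingAut S f →
    ∀ g : G, ∃ g' : G, ∀ x : G, f (x * g) = f x * g'


/-- Additive version of an S-ring relation. -/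
structure SR {R : Type*} [AddCommGroup R] (r : R → R → Prop) : Prop where
  eqv : Equivalence r
  zero : ∀ x, r 0 x → x = 0
  neg : ∀ x y, r x y → r (-x) (-y)
  cnt : ∀ a b z z', r z z' → {p : R × R | r a p.1 ∧ r b p.2 ∧ p.1 + p.2 = z}.ncard =
    {p : R × R | r a p.1 ∧ r b p.2 ∧ p.1 + p.2 = z'}.ncard

/-- A function is a class function. -/
def CF {R K : Type*} (r : R → R → Prop) (f : R → K) : Prop := ∀ x y, r x y → f x = f y

/-- closed sets = unions of classes -/
def CL {R : Type*} (r : R → R → Prop) (X : Set R) : Prop := ∀ x y, r x y → x ∈ X → y ∈ X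

namespace SR

section basic
variable {R : Type*} [AddCommGroup R] [Fintype R] {r : R → R → Prop}

open Classical in
theorem conv_pair (h : SR r) {K : Type*} [CommSemiring K] (f g : R → K) (hf : CF r f) (hg : CF r g) :
    CF r (fun z => ∑ p : R × R with p.1 + p.2 = z, f p.1 * g p.2) := by
  intro z z' hz
  let s : Setoid R := ⟨r, h.eqv⟩
  let F : Quotient s → K := Quotient.lift f (fun a b hab => hf a b hab)
  let G : Quotient s → K := Quotient.lift g (fun a b hab => hg a b hab)
  have key : ∀ w, ∑ p : R × R with p.1 + p.2 = w, f p.1 * g p.2 =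
      ∑ Q : Quotient s × Quotient s,
        ({p : R × R | r Q.1.out p.1 ∧ r Q.2.out p.2 ∧ p.1 + p.2 = w}.ncard : K) * (F Q.1 * G Q.2) := by
    intro w
    rw [← Finset.sum_fiberwise (s := Finset.univ.filter (fun p : R × R => p.1 + p.2 = w))
      (g := fun p : R × R => ((⟦p.1⟧, ⟦p.2⟧) : Quotient s × Quotient s))]
    refine Finset.sum_congr rfl fun Q _ => ?_
    rw [Finset.sum_congr rfl (g := fun _ => F Q.1 * G Q.2), Finset.sum_const, nsmul_eq_mul,
      Set.ncard_eq_toFinset_card']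
    · congr 3
      ext p
      simp only [Finset.mem_filter, Finset.mem_univ, true_and, Set.mem_toFinset, Set.mem_ofPred_eq,
        Prod.ext_iff]
      have e1 : ∀ (x : R) (q : Quotient s), ⟦x⟧ = q ↔ r q.out x := by
        intro x q
        constructor
        · rintro rfl
          exact Quotient.mk_out (s := s) x
        · intro hx
          have : (⟦q.out⟧ : Quotient s) = ⟦x⟧ := Quotient.sound hx
          rw [← this, Quotient.out_eq]
      rw [e1, e1]
      tauto
    · intro p hp
      simp only [Finset.mem_filter, Finset.mem_univ, true_and] at hp
      rw [← hp.2]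
      rfl
  simp only [key]
  refine Finset.sum_congr rfl fun Q _ => ?_
  rw [h.cnt _ _ _ _ hz]

theorem conv (h : SR r) {K : Type*} [CommSemiring K] (f g : R → K) (hf : CF r f) (hg : CF r g) :
    CF r (fun z => ∑ x, f x * g (z - x)) := by
  classical
  have := h.conv_pair f g hf hg
  convert this using 2 with z
  refine Finset.sum_bij' (i := fun x _ => (x, z - x)) (j := fun p _ => p.1) ?_ ?_ ?_ ?_ ?_
  · intro a _; simp
  · intro a _; simp
  · intro a _; simp
  · rintro ⟨a, b⟩ hab
    simp only [Finset.mem_filter, Finset.mem_univ, true_and] at hab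
    simp [← hab]
  · intro a _; simp

theorem refl (h : SR r) (x : R) : r x x := h.eqv.refl x
theorem symm (h : SR r) {x y : R} (k : r x y) : r y x := h.eqv.symm k
theorem trans (h : SR r) {x y z : R} (k : r x y) (l : r y z) : r x z := h.eqv.trans k l

theorem split (h : SR r) {x₁ x₂ y : R} (k : r (x₁ + x₂) y) :
    ∃ a b, r x₁ a ∧ r x₂ b ∧ y = a + b := by
  have := h.cnt x₁ x₂ _ _ k
  have hne : {p : R × R | r x₁ p.1 ∧ r x₂ p.2 ∧ p.1 + p.2 = y}.ncard ≠ 0 := by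
    rw [← this]
    apply Set.ncard_ne_zero_of_mem (a := (x₁, x₂))
    exact ⟨h.refl _, h.refl _, rfl⟩
  obtain ⟨⟨a, b⟩, h1, h2, h3⟩ := Set.nonempty_of_ncard_ne_zero hne
  exact ⟨a, b, h1, h2, h3.symm⟩

theorem cl_class (h : SR r) (x : R) : CL r {y | r x y} := fun _ _ k l => h.trans l k

open Classical in
theorem frob (h : SR r) (p : ℕ) [Fact p.Prime] (X : Set R) (hX : CL r X) :
    CL r {z | (({x ∈ X | p • x = z}.ncard : ℕ) : ZMod p) ≠ 0} := by
  let f : AddMonoidAlgebra (ZMod p) R := ∑ x ∈ X.toFinset, AddMonoidAlgebra.single x 1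
  have hf : CF r (fun z => f.coeff z) := by
    intro x y k
    have e : ∀ z, f.coeff z = if z ∈ X then 1 else 0 := by
      intro z
      simp only [f, AddMonoidAlgebra.coeff_sum, AddMonoidAlgebra.coeff_single,
        Finsupp.finsetSum_apply, Finsupp.single_apply]
      simp
    simp only [e]
    have : x ∈ X ↔ y ∈ X := ⟨hX _ _ k, hX _ _ (h.symm k)⟩
    simp [this]
  have hpow : ∀ k, CF r (fun z => (f ^ k).coeff z) := by
    intro k
    induction k with
    | zero =>
      intro x y k
      simp only [pow_zero, AddMonoidAlgebra.one_def, AddMonoidAlgebra.coeff_single,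
        Finsupp.single_apply]
      have : 0 = x ↔ 0 = y := by
        constructor
        · rintro rfl; exact (h.zero _ k).symm
        · rintro rfl; exact (h.zero _ (h.symm k)).symm
      simp [this]
    | succ k ih =>
      have := h.conv_pair _ _ ih hf
      intro x y hxy
      have h2 := this x y hxy
      simp only [pow_succ]
      rw [AddMonoidAlgebra.coeff_mul_antidiag _ _ _ (Finset.univ.filter (fun p : R × R => p.1 + p.2 = x)) (by simp),
        AddMonoidAlgebra.coeff_mul_antidiag _ _ _ (Finset.univ.filter (fun p : R × R => p.1 + p.2 = y)) (by simp)]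
      exact h2
  have e : ∀ z, (f ^ p).coeff z = (({x ∈ X | p • x = z}.ncard : ℕ) : ZMod p) := by
    intro z
    have : CharP (AddMonoidAlgebra (ZMod p) R) p := charP_of_injective_algebraMap (algebraMap (ZMod p) _).injective p
    simp only [f]
    rw [sum_pow_char]
    simp only [AddMonoidAlgebra.single_pow, one_pow, AddMonoidAlgebra.coeff_sum,
      AddMonoidAlgebra.coeff_single, Finsupp.finsetSum_apply, Finsupp.single_apply]
    rw [Finset.sum_ite, Set.ncard_eq_toFinset_card']
    simp only [Finset.sum_const, mul_zero, add_zero, nsmul_eq_mul, mul_one]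
    refine congrArg (fun s : Finset R => (s.card : ZMod p)) ?_
    ext x; simp
  intro x y k hx
  simp only [Set.mem_ofPred_eq, ← e] at hx ⊢
  have := hpow p x y k
  simp only at this
  rwa [← this]

end basic

section ring
variable {R : Type*} [CommRing R] [Fintype R] {r : R → R → Prop}

theorem cl_prime (h : SR r) (p : ℕ) (hp : p.Prime) (hu : IsUnit (p : R)) (X : Set R) (hX : CL r X) :
    CL r ((fun x => (p : R) * x) '' X) := by
  have := Fact.mk hp
  have := h.frob p X hX
  convert this using 1
  ext z
  simp only [Set.mem_image, Set.mem_ofPred_eq, nsmul_eq_mul]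
  constructor
  · rintro ⟨x, hx, rfl⟩
    have : {y ∈ X | (p : R) * y = p * x} = {x} := by
      ext y
      simp only [Set.mem_ofPred_eq, Set.mem_singleton_iff]
      constructor
      · rintro ⟨_, h2⟩; exact hu.mul_left_cancel h2
      · rintro rfl; exact ⟨hx, rfl⟩
    rw [this]; simp
  · intro hne
    have : {y ∈ X | (p : R) * y = z}.ncard ≠ 0 := by
      intro h0; rw [h0] at hne; simp at hne
    obtain ⟨x, hx, hz⟩ := Set.nonempty_of_ncard_ne_zero this
    exact ⟨x, hx, hz⟩

theorem cl_nat (h : SR r) (m : ℕ) : m ≠ 0 → IsUnit (m : R) → ∀ (X : Set R), CL r X →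
    CL r ((fun x => (m : R) * x) '' X) := by
  induction m using induction_on_primes with
  | zero => intro h0; exact absurd rfl h0
  | one => intro _ _ X hX; simpa using hX
  | prime_mul p a hp ih =>
    intro h0 hu X hX
    push_cast at hu
    have hpu := isUnit_of_mul_isUnit_left hu
    have hau := isUnit_of_mul_isUnit_right hu
    have := h.cl_prime p hp hpu _ (ih (by rintro rfl; simp at h0) hau X hX)
    rw [Set.image_image] at this
    convert this using 2
    push_cast; ring

theorem mult (h : SR r) (hs : Function.Surjective (Nat.cast : ℕ → R)) (u : Rˣ) {x y : R}
    (k : r x y) : r (u * x) (u * y) := by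
  obtain ⟨m, hm⟩ := hs (↑u⁻¹ : R)
  have hu : IsUnit (m : R) := by rw [hm]; exact Units.isUnit _
  by_cases h0 : m = 0
  · subst h0
    have : Subsingleton R := by
      rw [Nat.cast_zero] at hu
      exact isUnit_zero_iff.mp hu |> fun h => subsingleton_of_zero_eq_one h
    rw [Subsingleton.elim x y]; exact h.refl _
  have := h.cl_nat m h0 hu _ (h.cl_class (u * x)) x y k ⟨u * x, h.refl _, by simp [hm]⟩
  obtain ⟨w, hw, hy⟩ := this
  have : u * y = w := by rw [← hy]; simp [hm]
  rw [this]; exact hw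

theorem mult_iff (h : SR r) (hs : Function.Surjective (Nat.cast : ℕ → R)) (u : Rˣ) {x y : R} :
    r (u * x) (u * y) ↔ r x y :=
  ⟨fun k => by simpa using h.mult hs u⁻¹ k, h.mult hs u⟩

end ring
end SR


section zmodfacts
variable {p e : ℕ} [hp : Fact p.Prime]

theorem zm_dvd_iff (he : e ≠ 0) (m k : ℕ) (hk : k ≤ e) :
    ((p : ZMod (p ^ e)) ^ k ∣ (m : ZMod (p ^ e))) ↔ p ^ k ∣ m := by
  constructor
  · rintro ⟨c, hc⟩
    rw [← ZMod.natCast_zmod_val c] at hc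
    have : ((m : ℕ) : ZMod (p ^ e)) = ((p ^ k * c.val : ℕ) : ZMod (p ^ e)) := by
      rw [hc]; push_cast; rfl
    rw [ZMod.natCast_eq_natCast_iff] at this
    have h2 := this.of_dvd (pow_dvd_pow p hk)
    rw [Nat.ModEq, Nat.mul_mod_right] at h2
    exact Nat.dvd_of_mod_eq_zero h2
  · rintro ⟨c, rfl⟩
    push_cast
    exact dvd_mul_right _ _

theorem zm_isUnit_iff (he : e ≠ 0) (x : ZMod (p ^ e)) :
    IsUnit x ↔ ¬ ((p : ZMod (p ^ e)) ∣ x) := by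
  rw [← ZMod.natCast_zmod_val x, ZMod.isUnit_iff_coprime]
  have := zm_dvd_iff (p := p) he x.val 1 (Nat.one_le_iff_ne_zero.mpr he)
  rw [pow_one, pow_one] at this
  rw [this, Nat.coprime_pow_right_iff (Nat.pos_of_ne_zero he), Nat.coprime_comm,
    Nat.Prime.coprime_iff_not_dvd hp.out]

theorem zm_pow_self : (p : ZMod (p ^ e)) ^ e = 0 := by
  have := ZMod.natCast_self (p ^ e)
  push_cast at this
  exact this

theorem zm_factor (he : e ≠ 0) (x : ZMod (p ^ e)) :
    ∃ k ≤ e, ∃ u : (ZMod (p ^ e))ˣ, x = (p : ZMod (p ^ e)) ^ k * u := by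
  by_cases hx : x = 0
  · exact ⟨e, le_rfl, 1, by rw [zm_pow_self]; simpa using hx⟩
  · have hv : x.val ≠ 0 := by rwa [Ne, ZMod.val_eq_zero]
    obtain ⟨k, m, hm, hk⟩ := Nat.exists_eq_pow_mul_and_not_dvd hv p hp.out.ne_one
    have hu : IsUnit (m : ZMod (p ^ e)) := by
      rw [zm_isUnit_iff he]
      have := zm_dvd_iff (p := p) he m 1 (Nat.one_le_iff_ne_zero.mpr he)
      rw [pow_one, pow_one] at this
      rwa [this]
    refine ⟨k, ?_, hu.unit, ?_⟩
    · by_contra hlt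
      push Not at hlt
      apply hx
      rw [← ZMod.natCast_zmod_val x, hk]
      push_cast
      rw [show k = e + (k - e) by omega, pow_add, zm_pow_self]; simp
    · conv_lhs => rw [← ZMod.natCast_zmod_val x, hk]
      push_cast; simp

theorem zm_dvd_of_mul (he : e ≠ 0) (k : ℕ) (hk : k ≤ e) (x : ZMod (p ^ e))
    (h : (p : ZMod (p ^ e)) ^ k * x = 0) : (p : ZMod (p ^ e)) ^ (e - k) ∣ x := by
  rw [← ZMod.natCast_zmod_val x] at h ⊢
  rw [zm_dvd_iff he _ _ (Nat.sub_le _ _)]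
  have : ((p ^ k * x.val : ℕ) : ZMod (p ^ e)) = 0 := by push_cast; exact_mod_cast h
  rw [ZMod.natCast_eq_zero_iff] at this
  have e1 : p ^ e = p ^ k * p ^ (e - k) := by rw [← pow_add]; congr 1; omega
  generalize x.val = m at this
  rw [e1] at this
  exact Nat.dvd_of_mul_dvd_mul_left (pow_pos hp.out.pos k) this

theorem zm_assoc (he : e ≠ 0) (x y : ZMod (p ^ e))
    (h : ∀ k ≤ e, (p : ZMod (p ^ e)) ^ k ∣ x ↔ (p : ZMod (p ^ e)) ^ k ∣ y) :
    ∃ u : (ZMod (p ^ e))ˣ, y = u * x := by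
  obtain ⟨a, ha, u, hx⟩ := zm_factor he x
  obtain ⟨b, hb, v, hy⟩ := zm_factor he y
  have hpa : (p : ZMod (p ^ e)) ^ a ∣ (p : ZMod (p ^ e)) ^ b := by
    have := (h a ha).1 (by rw [hx]; exact dvd_mul_right _ _)
    rw [hy] at this
    exact (Units.dvd_mul_right).1 this
  have hpb : (p : ZMod (p ^ e)) ^ b ∣ (p : ZMod (p ^ e)) ^ a := by
    have := (h b hb).2 (by rw [hy]; exact dvd_mul_right _ _)
    rw [hx] at this
    exact (Units.dvd_mul_right).1 this
  have hpp : (p : ZMod (p ^ e)) ^ a = (p : ZMod (p ^ e)) ^ b := by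
    rcases lt_trichotomy a b with hab | hab | hab
    · have := (zm_dvd_iff (p := p) he (p ^ a) b hb).1 (by push_cast; exact hpb)
      rw [Nat.pow_dvd_pow_iff_le_right hp.out.one_lt] at this
      omega
    · rw [hab]
    · have := (zm_dvd_iff (p := p) he (p ^ b) a ha).1 (by push_cast; exact hpa)
      rw [Nat.pow_dvd_pow_iff_le_right hp.out.one_lt] at this
      omega
  refine ⟨v * u⁻¹, ?_⟩
  rw [hx, hy, hpp]
  push_cast
  have : (u : ZMod (p ^ e)) * (↑u⁻¹ : ZMod (p ^ e)) = 1 := u.mul_inv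
  linear_combination (-(p : ZMod (p ^ e)) ^ b * v) * this

theorem zm_card_ker (he : e ≠ 0) :
    {x : ZMod (p ^ e) | (p : ZMod (p ^ e)) * x = 0}.ncard ≤ p := by
  have hsub : {x : ZMod (p ^ e) | (p : ZMod (p ^ e)) * x = 0} ⊆
      ((Finset.range p).image (fun m : ℕ => (p : ZMod (p ^ e)) ^ (e - 1) * m) : Finset _) := by
    intro x hx
    simp only [Set.mem_ofPred_eq] at hx
    obtain ⟨c, hc⟩ := zm_dvd_of_mul he 1 (by omega) x (by simpa using hx)
    simp only [Finset.coe_image, Set.mem_image, Finset.mem_coe, Finset.mem_range]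
    refine ⟨c.val % p, Nat.mod_lt _ hp.out.pos, ?_⟩
    conv_rhs => rw [hc, ← ZMod.natCast_zmod_val c, ← Nat.mod_add_div c.val p]
    push_cast
    rw [mul_add, ← mul_assoc _ (p : ZMod (p ^ e)), ← pow_succ, show e - 1 + 1 = e by omega,
      zm_pow_self]
    simp
  calc _ ≤ _ := Set.ncard_le_ncard hsub (Finset.finite_toSet _)
    _ ≤ p := by
      rw [Set.ncard_coe_finset]
      exact Finset.card_image_le.trans (by simp)

end zmodfacts


/-- product of the rings `ZMod (q i ^ e i)` -/
abbrev RR {ι : Type*} (q e : ι → ℕ) := ∀ i, ZMod (q i ^ e i)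

/-- consequence of normality: no nontrivial wreath structure -/
def WI {R : Type*} [AddCommGroup R] (r : R → R → Prop) : Prop :=
  ∀ U : AddSubgroup R, U ≠ ⊤ → ∀ h ∈ U, h ≠ 0 → ¬ ∀ y, y ∉ U → r y (y + h)

section closedness
variable {ι : Type*} [Fintype ι] [DecidableEq ι] {q e : ι → ℕ} [hq : ∀ i, Fact (q i).Prime]
  {r : RR q e → RR q e → Prop}

/-- ideals -/
def DD (q e : ι → ℕ) (i : ι) (k : ℕ) : Set (RR q e) := {y | (q i : ZMod (q i ^ e i)) ^ k ∣ y i}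

/-- the subgroup of order `q i` -/
def HH (q e : ι → ℕ) (i : ι) : Set (RR q e) :=
  {h | (∀ j, j ≠ i → h j = 0) ∧ (q i : ZMod (q i ^ e i)) * h i = 0}

theorem HH_card (he : ∀ i, e i ≠ 0) (i : ι) : (HH q e i).ncard ≤ q i := by
  refine le_trans ?_ (zm_card_ker (p := q i) (he i))
  refine Set.ncard_le_ncard_of_injOn (fun h => h i) ?_ ?_ (Set.toFinite _)
  · intro h hh; exact hh.2
  · intro h hh k hk hik
    funext j
    by_cases hj : j = i
    · subst hj; exact hik
    · rw [hh.1 j hj, hk.1 j hj]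

theorem q_unit (hinj : Function.Injective q) {i j : ι} (h : j ≠ i) :
    IsUnit ((q i : ZMod (q j ^ e j))) := by
  rw [ZMod.isUnit_iff_coprime]
  apply Nat.Coprime.pow_right
  exact (Nat.coprime_primes (hq i).out (hq j).out).2 (fun hh => h (hinj hh).symm)

theorem HH_iff (hinj : Function.Injective q) (i : ι) (h : RR q e) :
    h ∈ HH q e i ↔ (q i) • h = 0 := by
  constructor
  · rintro ⟨h1, h2⟩
    funext j
    by_cases hj : j = i
    · subst hj; simpa using h2
    · simp [h1 j hj]
  · intro hh
    refine ⟨fun j hj => ?_, ?_⟩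
    · have := congrFun hh j
      simp only [Pi.smul_apply, nsmul_eq_mul, Pi.zero_apply] at this
      exact (q_unit hinj hj).mul_right_eq_zero.1 this
    · have := congrFun hh i
      simpa using this

theorem cast_smul_i (m : ℕ) (y : RR q e) (i : ι) : (m • y) i = (m : ZMod (q i ^ e i)) * y i := by
  simp

theorem count_ne (he : ∀ i, e i ≠ 0) (hinj : Function.Injective q) (i : ι) (X : Set (RR q e))
    (y : RR q e) (hy : y ∈ X) (hno : ¬ ∀ h ∈ HH q e i, y + h ∈ X) :
    (({x ∈ X | q i • x = q i • y}.ncard : ℕ) : ZMod (q i)) ≠ 0 := by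
  have hsub : {x ∈ X | q i • x = q i • y} ⊆ (fun h => y + h) '' HH q e i := by
    rintro x ⟨_, hx⟩
    refine ⟨x - y, ?_, by simp⟩
    rw [HH_iff hinj, smul_sub, hx, sub_self]
  have hss : {x ∈ X | q i • x = q i • y} ⊂ (fun h => y + h) '' HH q e i := by
    refine ⟨hsub, fun hsup => hno fun h hh => ?_⟩
    exact (hsup ⟨h, hh, rfl⟩).1
  have hlt := Set.ncard_lt_ncard hss (Set.toFinite _)
  have hle : ((fun h => y + h) '' HH q e i).ncard ≤ q i :=
    (Set.ncard_image_le (Set.toFinite _)).trans (HH_card he i)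
  have hpos : {x ∈ X | q i • x = q i • y}.ncard ≠ 0 :=
    Set.ncard_ne_zero_of_mem (a := y) ⟨hy, rfl⟩
  intro h0
  rw [ZMod.natCast_eq_zero_iff] at h0
  exact absurd (Nat.le_of_dvd (Nat.pos_of_ne_zero hpos) h0) (by omega)

theorem mem_T {p : ℕ} {R : Type*} [AddCommGroup R] (X : Set R) (z : R)
    (h : (({x ∈ X | p • x = z}.ncard : ℕ) : ZMod p) ≠ 0) : ∃ x ∈ X, p • x = z := by
  have : {x ∈ X | p • x = z}.ncard ≠ 0 := by
    intro h0; rw [h0] at h; simp at h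
  obtain ⟨x, hx, hz⟩ := Set.nonempty_of_ncard_ne_zero this
  exact ⟨x, hx, hz⟩

theorem pow_formula {R : Type*} [CommRing R] (y g b : R) (hg : g = y * b) (hb : b * b * g = 0) (k : ℕ) :
    (1 + b) ^ k * y = y + k * g + (k.choose 2 : ℕ) * (b * g) := by
  induction k with
  | zero => simp
  | succ k ih =>
    rw [pow_succ', mul_assoc, ih, Nat.choose_succ_succ' k 1, Nat.choose_one_right]
    push_cast
    linear_combination (k.choose 2 : R) * hb - hg

theorem level (h : SR r) (hs : Function.Surjective (Nat.cast : ℕ → RR q e)) (he : ∀ i, e i ≠ 0)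
    (hinj : Function.Injective q) (i : ι) (hodd : q i ≠ 2) (j : ℕ) (hj : j + 1 ≤ e i)
    (hD : ∀ k ≤ j, CL r (DD q e i k)) (V : AddSubgroup (RR q e))
    (hV : ∀ v, v ∈ V ↔ ∀ w, r v w → w ∈ DD q e i (j + 1)) (d : ℕ) : d ≤ j → 
    ∀ y ∈ DD q e i (j - d), (d = 0 ∨ y ∉ DD q e i (j - d + 1)) → (q i) ^ (d + 1) • y ∉ V →
    ∀ x ∈ HH q e i, r y (y + x) := by
  induction d with
  | zero =>
    intro _ y hy _ hyV
    by_contra hno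
    have hT := count_ne he hinj i {w | r y w} y (h.refl y) hno
    apply hyV
    rw [hV]
    intro w hw
    have hwT := h.frob (q i) _ (h.cl_class y) _ w (by simpa using hw) hT
    obtain ⟨x, hx, rfl⟩ := mem_T _ _ hwT
    have hxD := hD j le_rfl y x hx (by simpa using hy)
    simp only [DD, Set.mem_ofPred_eq] at hxD ⊢
    rw [cast_smul_i, pow_succ']
    exact mul_dvd_mul_left _ hxD
  | succ d ih =>
    intro hdj y hy hy2 hyV
    have hk : j - d = j - (d + 1) + 1 := by omega
    set k := j - (d + 1) with hkdef
    have hyn : y ∉ DD q e i (k + 1) := by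
      rcases hy2 with h0 | h0
      · omega
      · exact h0
    have ihy : ∀ x ∈ HH q e i, r (q i • y) (q i • y + x) := by
      apply ih (by omega)
      · rw [hk]
        simp only [DD, Set.mem_ofPred_eq] at hy ⊢
        rw [cast_smul_i, pow_succ']
        exact mul_dvd_mul_left _ hy
      · right
        rw [hk]
        intro hc
        apply hyn
        simp only [DD, Set.mem_ofPred_eq] at hc ⊢
        rw [cast_smul_i] at hc
        obtain ⟨z, hz⟩ := hc
        have := zm_dvd_of_mul (he i) 1 (by omega) (y i - (q i : ZMod (q i ^ e i)) ^ (k + 1) * z)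
          (by rw [mul_sub, pow_one, hz]; ring)
        have h2 := (pow_dvd_pow (q i : ZMod (q i ^ e i)) (show k + 1 ≤ e i - 1 by omega)).trans this
        exact (dvd_sub_left (dvd_mul_right _ _)).1 h2
      · rw [smul_smul, ← pow_succ]; exact hyV
    by_contra hno
    have hT := count_ne he hinj i {w | r y w} y (h.refl y) hno
    have hw : ∀ x ∈ HH q e i, ∃ w, r y w ∧ q i • w = q i • y + x := by
      intro x hx
      have hwT := h.frob (q i) _ (h.cl_class y) _ _ (ihy x hx) hT
      exact mem_T _ _ hwT
    have hDk : CL r (DD q e i (k + 1)) := hD _ (by omega)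
    by_cases hek : e i = k + 2
    · obtain ⟨w, hw1, hw2⟩ := hw (Pi.single i (-(q i • y) i)) (by
        refine ⟨fun j hj => by simp [hj], ?_⟩
        obtain ⟨c, hc⟩ := hy
        rw [Pi.single_eq_same, cast_smul_i, hc]
        have := zm_pow_self (p := q i) (e := e i)
        have e2 : (q i : ZMod (q i ^ e i)) ^ e i = (q i : ZMod (q i ^ e i)) ^ (k + 2) := by
          congr 1
        rw [e2] at this
        linear_combination (-c) * this)
      apply hyn
      apply hDk w y (h.symm hw1)
      have := congrFun hw2 i
      rw [cast_smul_i, Pi.add_apply, Pi.single_eq_same, add_neg_cancel] at this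
      have h3 := zm_dvd_of_mul (he i) 1 (by omega) (w i) (by simpa using this)
      have h4 : e i - 1 = k + 1 := by omega
      rw [h4] at h3
      exact h3
    · apply hno
      intro x hx
      obtain ⟨w, hw1, hw2⟩ := hw x hx
      have hg : q i • (w - y) = x := by rw [smul_sub, hw2]; abel
      -- construct b
      have hgi : ∀ l, l ≠ i → (w - y) l = 0 := by
        intro l hl
        have := congrFun hg l
        rw [cast_smul_i, hx.1 l hl] at this
        exact (q_unit hinj hl).mul_right_eq_zero.1 this
      have hg2 : (q i : ZMod (q i ^ e i)) ^ 2 * (w - y) i = 0 := by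
        have := congrFun hg i
        rw [cast_smul_i] at this
        rw [pow_two, mul_assoc, this, hx.2]
      obtain ⟨c, hc⟩ := zm_dvd_of_mul (he i) 2 (by omega) _ hg2
      obtain ⟨a, ha, u, hyu⟩ := zm_factor (he i) (y i)
      have hak : a = k := by
        apply le_antisymm
        · by_contra hlt
          apply hyn
          simp only [DD, Set.mem_ofPred_eq]
          rw [hyu]
          exact (pow_dvd_pow _ (by omega)).trans (dvd_mul_right _ _)
        · have h1 : (q i : ZMod (q i ^ e i)) ^ k ∣ (q i : ZMod (q i ^ e i)) ^ a := by
            simp only [DD, Set.mem_ofPred_eq] at hy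
            rw [hyu] at hy
            exact Units.dvd_mul_right.1 hy
          have := (zm_dvd_iff (p := q i) (he i) (q i ^ a) k (by omega)).1 (by push_cast; exact h1)
          rwa [Nat.pow_dvd_pow_iff_le_right (hq i).out.one_lt] at this
      subst a
      set P : ZMod (q i ^ e i) := (q i : ZMod (q i ^ e i)) with hP
      let bi : ZMod (q i ^ e i) := P ^ (e i - 2 - k) * c * (↑u⁻¹ : ZMod (q i ^ e i))
      let b : RR q e := Pi.single i bi
      have huu : (u : ZMod (q i ^ e i)) * (↑u⁻¹ : ZMod (q i ^ e i)) = 1 := u.mul_inv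
      have hpe : P ^ (e i - 2) = P ^ k * P ^ (e i - 2 - k) := by
        rw [← pow_add]; congr 1; omega
      have hgb : (w - y) = y * b := by
        funext l
        by_cases hl : l = i
        · subst hl
          rw [hc, Pi.mul_apply, hyu, hpe]
          simp only [b, Pi.single_eq_same, bi]
          linear_combination (-P ^ k * P ^ (e l - 2 - k) * c) * huu
        · rw [hgi l hl]; simp [b, hl]
      have hdb : P ∣ bi := by
        have : P ∣ P ^ (e i - 2 - k) := dvd_pow_self _ (by omega)
        exact (this.mul_right _).mul_right _
      obtain ⟨b', hb'⟩ := hdb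
      have hun : IsUnit (1 + b) := by
        rw [Pi.isUnit_iff]
        intro l
        by_cases hl : l = i
        · subst hl
          rw [zm_isUnit_iff (he l)]
          intro hd
          have h1 : (1 + b) l = 1 + P * b' := by simp [b, hb']
          rw [h1] at hd
          have h2 := (dvd_add_left (dvd_mul_right P b')).1 hd
          have h3 := (zm_isUnit_iff (p := q l) (he l) 1).1 isUnit_one
          exact h3 h2
        · simp [b, hl]
      obtain ⟨a', ha'⟩ := hun
      have hbb : b * b * (w - y) = 0 := by
        funext l
        by_cases hl : l = i
        · subst hl
          simp only [Pi.mul_apply, b, Pi.single_eq_same, Pi.zero_apply, hb']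
          linear_combination (b' * b') * hg2
        · rw [Pi.mul_apply, hgi l hl]; simp
      have hpb : (q i : RR q e) * (b * (w - y)) = 0 := by
        funext l
        by_cases hl : l = i
        · subst hl
          simp only [Pi.mul_apply, b, Pi.single_eq_same, Pi.zero_apply, hb', Pi.natCast_apply]
          linear_combination b' * hg2
        · rw [Pi.mul_apply, Pi.mul_apply, hgi l hl]; simp
      have hpf := pow_formula y (w - y) b hgb hbb (q i)
      have hcz : ((q i).choose 2 : RR q e) * (b * (w - y)) = 0 := by
        obtain ⟨m, hm⟩ := (hq i).out.dvd_choose_self (k := 2) (by norm_num)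
          (lt_of_le_of_ne (hq i).out.two_le (Ne.symm hodd))
        rw [hm]; push_cast
        linear_combination (m : RR q e) * hpb
      rw [hcz, add_zero, ← nsmul_eq_mul, hg, ← ha'] at hpf
      have hstep : ∀ k : ℕ, r y ((a' : RR q e) ^ k * y) := by
        intro k
        induction k with
        | zero => simpa using h.refl y
        | succ k ihk =>
          have h1 := h.mult hs a' ihk
          have h2 : (a' : RR q e) * y = w := by
            rw [ha', add_mul, one_mul, mul_comm b, ← hgb]; abel
          rw [h2, ← mul_assoc, ← pow_succ'] at h1
          exact h.trans hw1 h1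
      rw [← hpf]
      exact hstep _

theorem DD_closed (h : SR r) (hw : WI r) (hs : Function.Surjective (Nat.cast : ℕ → RR q e))
    (he : ∀ i, e i ≠ 0)
    (hinj : Function.Injective q) (hodd : ∀ i, q i ≠ 2) (i : ι) (k : ℕ) (hk : k ≤ e i) :
    CL r (DD q e i k) := by
  induction k using Nat.strong_induction_on with
  | _ k ih =>
  rcases Nat.eq_zero_or_pos k with rfl | hpos
  · intro x y _ _
    simp [DD]
  obtain ⟨j, rfl⟩ : ∃ j, k = j + 1 := ⟨k - 1, by omega⟩
  have hD : ∀ k ≤ j, CL r (DD q e i k) := fun k hk' => ih k (by omega) (by omega)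
  let V : AddSubgroup (RR q e) :=
    { carrier := {v | ∀ w, r v w → w ∈ DD q e i (j + 1)}
      zero_mem' := by
        intro w hw
        rw [h.zero w hw]; simp [DD]
      add_mem' := by
        intro a b ha hb w hw
        obtain ⟨x, y, hx, hy, rfl⟩ := h.split hw
        exact dvd_add (ha x hx) (hb y hy)
      neg_mem' := by
        intro a ha w hw
        have := ha (-w) (by simpa using h.neg _ _ hw)
        simp only [DD, Set.mem_ofPred_eq, Pi.neg_apply, dvd_neg] at this ⊢
        exact this }
  have hV : ∀ v, v ∈ V ↔ ∀ w, r v w → w ∈ DD q e i (j + 1) := fun v => Iff.rfl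
  let U : AddSubgroup (RR q e) := V.comap (nsmulAddMonoidHom (q i ^ (j + 1)))
  have hU : ∀ y, y ∈ U ↔ q i ^ (j + 1) • y ∈ V := fun y => Iff.rfl
  by_cases hUt : U = ⊤
  · intro x y hxy hx
    obtain ⟨c, hc⟩ := hx
    have hxV : x ∈ V := by
      have huu : ∃ z : RR q e, x = q i ^ (j + 1) • z := by
        have : ∀ l, ∃ z : ZMod (q l ^ e l), x l = ((q i ^ (j + 1) : ℕ) : ZMod (q l ^ e l)) * z := by
          intro l
          by_cases hl : l = i
          · subst hl; exact ⟨c, by rw [hc]; push_cast; rfl⟩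
          · have hu : IsUnit ((q i ^ (j + 1) : ℕ) : ZMod (q l ^ e l)) := by
              push_cast; exact (q_unit hinj hl).pow _
            obtain ⟨u, hu⟩ := hu
            exact ⟨↑u⁻¹ * x l, by rw [← hu]; simp⟩
        choose z hz using this
        exact ⟨z, by funext l; rw [cast_smul_i, hz]⟩
      obtain ⟨z, hz⟩ := huu
      rw [hz, ← hU, hUt]; trivial
    exact (hV x).1 hxV y hxy
  · exfalso
    have hne : (Pi.single i ((q i : ZMod (q i ^ e i)) ^ (e i - 1)) : RR q e) ≠ 0 := by
      intro h0
      have := congrFun h0 i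
      rw [Pi.single_eq_same, Pi.zero_apply] at this
      have h2 : ((q i ^ (e i - 1) : ℕ) : ZMod (q i ^ e i)) = 0 := by push_cast; exact this
      rw [ZMod.natCast_eq_zero_iff, Nat.pow_dvd_pow_iff_le_right (hq i).out.one_lt] at h2
      have := he i
      omega
    have hmem : (Pi.single i ((q i : ZMod (q i ^ e i)) ^ (e i - 1)) : RR q e) ∈ HH q e i := by
      refine ⟨fun l hl => by simp [hl], ?_⟩
      rw [Pi.single_eq_same, ← pow_succ', show e i - 1 + 1 = e i by have := he i; omega,
        zm_pow_self]
    refine hw U hUt _ ?_ hne ?_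
    · rw [hU, pow_succ, ← smul_smul, (HH_iff hinj i _).1 hmem, smul_zero]
      exact V.zero_mem
    · intro y hy
      -- find the level
      have hfind : ∃ d ≤ j, y ∈ DD q e i (j - d) ∧ (d = 0 ∨ y ∉ DD q e i (j - d + 1)) := by
        by_cases hyj : y ∈ DD q e i j
        · exact ⟨0, Nat.zero_le _, hyj, Or.inl rfl⟩
        · have hex : ∃ m, y ∉ DD q e i m := ⟨j, hyj⟩
          classical
          have hsp := Nat.find_spec hex
          have hle : Nat.find hex ≤ j := Nat.find_min' hex hyj
          have h0 : Nat.find hex ≠ 0 := by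
            intro h0
            rw [h0] at hsp
            exact hsp (by simp [DD])
          have hmin := Nat.find_min hex (m := Nat.find hex - 1) (by omega)
          refine ⟨j - (Nat.find hex - 1), by omega, ?_, Or.inr ?_⟩
          · rw [show j - (j - (Nat.find hex - 1)) = Nat.find hex - 1 by omega]
            exact not_not.1 hmin
          · rw [show j - (j - (Nat.find hex - 1)) + 1 = Nat.find hex by omega]
            exact hsp
      obtain ⟨d, hd, hd1, hd2⟩ := hfind
      refine level h hs he hinj i (hodd i) j hk hD V hV d hd y hd1 hd2 ?_ _ hmem
      intro hc
      apply hy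
      rw [hU]
      have := V.nsmul_mem hc (q i ^ (j - d))
      rwa [smul_smul, ← pow_add, show j - d + (d + 1) = j + 1 by omega] at this

theorem assoc_of_rel (h : SR r) (hw : WI r) (hs : Function.Surjective (Nat.cast : ℕ → RR q e))
    (he : ∀ i, e i ≠ 0)
    (hinj : Function.Injective q) (hodd : ∀ i, q i ≠ 2) {x y : RR q e} (k : r x y) :
    ∃ u : (RR q e)ˣ, y = u * x := by
  have : ∀ i, ∃ u : (ZMod (q i ^ e i))ˣ, y i = u * x i := by
    intro i
    apply zm_assoc (he i)
    intro m hm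
    exact ⟨DD_closed h hw hs he hinj hodd i m hm x y k,
      DD_closed h hw hs he hinj hodd i m hm y x (h.symm k)⟩
  choose u hu using this
  exact ⟨MulEquiv.piUnits.symm u, by funext i; rw [hu]; rfl⟩

end closedness


/-- all standing assumptions -/
structure Ctx {ι : Type*} [Fintype ι] (q e : ι → ℕ) (r : RR q e → RR q e → Prop) : Prop where
  sr : SR r
  wi : WI r
  hs : Function.Surjective (Nat.cast : ℕ → RR q e)
  he : ∀ i, e i ≠ 0
  hinj : Function.Injective q
  hodd : ∀ i, q i ≠ 2

theorem one_add_pow_sq_zero {R : Type*} [CommRing R] (g : R) (hg : g * g = 0) (k : ℕ) :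
    (1 + g) ^ k = 1 + k * g := by
  induction k with
  | zero => simp
  | succ k ih =>
    rw [pow_succ, ih]; push_cast
    linear_combination (k : R) * hg

theorem geom_p_unit {p e : ℕ} [hp : Fact p.Prime] (he : e ≠ 0) (hodd : p ≠ 2) (b : ZMod (p ^ e)) :
    ∃ u : (ZMod (p ^ e))ˣ, ∑ k ∈ Finset.range p, (1 + p * b) ^ k = p * u := by
  have h1 : ∀ k : ℕ, ∃ c : ZMod (p ^ e), (1 + p * b) ^ k = 1 + k * (p * b) + p ^ 2 * c := by
    intro k
    induction k with
    | zero => exact ⟨0, by simp⟩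
    | succ k ih =>
      obtain ⟨c, hc⟩ := ih
      refine ⟨k * b ^ 2 + c * (1 + p * b), ?_⟩
      rw [pow_succ, hc]; push_cast; ring
  choose c hc using h1
  have h2 : ∃ m : ℕ, ∑ k ∈ Finset.range p, k = p * m := by
    rw [Finset.sum_range_id]
    have : 2 ∣ p - 1 := by
      have := hp.out.eq_two_or_odd
      omega
    obtain ⟨m, hm⟩ := this
    exact ⟨m, by rw [hm, mul_comm 2 m, ← mul_assoc]; simp⟩
  obtain ⟨m, hm⟩ := h2
  have hu : IsUnit (1 + p * (m * b + ∑ k ∈ Finset.range p, c k) : ZMod (p ^ e)) := by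
    rw [zm_isUnit_iff he]
    intro hd
    exact (zm_isUnit_iff (p := p) he 1).1 isUnit_one ((dvd_add_left (dvd_mul_right _ _)).1 hd)
  obtain ⟨u, hu⟩ := hu
  refine ⟨u, ?_⟩
  have hm' : ∑ k ∈ Finset.range p, (k : ZMod (p ^ e)) = p * m := by
    have := congrArg (Nat.cast : ℕ → ZMod (p ^ e)) hm
    push_cast at this
    exact this
  rw [hu]
  simp only [hc]
  rw [Finset.sum_add_distrib, Finset.sum_add_distrib, ← Finset.sum_mul, hm', ← Finset.mul_sum]
  simp only [Finset.sum_const, Finset.card_range, nsmul_eq_mul, mul_one]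
  ring

theorem geom_r_unit {p e : ℕ} [hp : Fact p.Prime] (he : e ≠ 0) (r : ℕ) (hr : r.Prime) (hne : p ≠ r)
    (b : ZMod (p ^ e)) : IsUnit (∑ k ∈ Finset.range r, (1 + p * b) ^ k) := by
  have h1 : ∀ k : ℕ, ∃ c : ZMod (p ^ e), (1 + p * b) ^ k = 1 + p * c := by
    intro k
    induction k with
    | zero => exact ⟨0, by simp⟩
    | succ k ih =>
      obtain ⟨c, hc⟩ := ih
      refine ⟨c + b + p * c * b, ?_⟩
      rw [pow_succ, hc]; ring
  choose c hc using h1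
  simp only [hc]
  rw [Finset.sum_add_distrib, ← Finset.mul_sum]
  simp only [Finset.sum_const, Finset.card_range, nsmul_eq_mul, mul_one]
  rw [zm_isUnit_iff he]
  intro hd
  have h2 := (dvd_add_left (dvd_mul_right _ _)).1 hd
  have h3 := (zm_dvd_iff (p := p) he r 1 (by omega)).1 (by simpa using h2)
  rw [pow_one] at h3
  exact hne ((Nat.prime_dvd_prime_iff_eq hp.out hr).1 h3)

section hall
variable {ι : Type*} [Fintype ι] [DecidableEq ι] {q e : ι → ℕ} [hq : ∀ i, Fact (q i).Prime]
  {r : RR q e → RR q e → Prop}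

/-- principal congruence units -/
def Om (q e : ι → ℕ) : Subgroup (RR q e)ˣ where
  carrier := {u | ∀ i, (q i : ZMod (q i ^ e i)) ∣ (u : RR q e) i - 1}
  one_mem' := by intro i; simp
  mul_mem' := by
    intro a b ha hb i
    have h : ((a * b : (RR q e)ˣ) : RR q e) i - 1 =
        ((a : RR q e) i - 1) * (b : RR q e) i + ((b : RR q e) i - 1) := by
      rw [Units.val_mul, Pi.mul_apply]; ring
    rw [h]
    exact dvd_add ((ha i).mul_right _) (hb i)
  inv_mem' := by
    intro a ha i
    have h1 : (a : RR q e) i * ((a⁻¹ : (RR q e)ˣ) : RR q e) i = 1 := by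
      rw [← Pi.mul_apply, Units.mul_inv]; rfl
    have h : ((a⁻¹ : (RR q e)ˣ) : RR q e) i - 1 =
        ((a : RR q e) i - 1) * (-((a⁻¹ : (RR q e)ˣ) : RR q e) i) := by
      linear_combination h1
    rw [h]
    exact (ha i).mul_right _

/-- the unit `1 + h`, lemma f2 -/
theorem f2 (he : ∀ i, e i ≠ 0) (hinj : Function.Injective q) (hodd : ∀ i, q i ≠ 2)
    (M : Subgroup (RR q e)ˣ) (u : (RR q e)ˣ) (hu : u ∈ M) (hu1 : u ≠ 1) (huO : u ∈ Om q e) :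
    ∃ i, 2 ≤ e i ∧ ∀ h ∈ HH q e i, ∃ v ∈ M, (v : RR q e) = 1 + h := by
  have ho : orderOf u ≠ 1 := by rwa [Ne, orderOf_eq_one_iff]
  obtain ⟨s, hs, hsd⟩ := Nat.exists_prime_and_dvd ho
  have hos : orderOf (u ^ (orderOf u / s)) = s := by
    rw [orderOf_pow_of_dvd]
    · exact Nat.div_div_self hsd (orderOf_pos u).ne'
    · have := Nat.div_pos (Nat.le_of_dvd (orderOf_pos u) hsd) hs.pos
      omega
    · exact Nat.div_dvd_of_dvd hsd
  set v := u ^ (orderOf u / s) with hv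
  have hvM : v ∈ M := M.pow_mem hu _
  have hvO : v ∈ Om q e := (Om q e).pow_mem huO _
  have hv1 : v ≠ 1 := by
    intro h1
    rw [h1, orderOf_one] at hos
    exact hs.ne_one hos.symm
  have hvs : v ^ s = 1 := by rw [← hos]; exact pow_orderOf_eq_one v
  have hgeom : ∀ j, (∑ k ∈ Finset.range s, ((v : RR q e) j) ^ k) * ((v : RR q e) j - 1) = 0 := by
    intro j
    rw [geom_sum_mul]
    have := congrFun (congrArg Units.val hvs) j
    rw [Units.val_pow_eq_pow_val, Pi.pow_apply] at this
    rw [this]; simp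
  have hA : ∀ j, q j ≠ s → (v : RR q e) j - 1 = 0 := by
    intro j hj
    obtain ⟨b, hb⟩ := hvO j
    have h1 := hgeom j
    have h2 := geom_r_unit (p := q j) (he j) s hs hj b
    rw [show (v : RR q e) j = 1 + q j * b by rw [← hb]; ring] at h1 ⊢
    exact h2.mul_right_eq_zero.1 h1
  have hB : ∀ j, q j = s → (q j : ZMod (q j ^ e j)) * ((v : RR q e) j - 1) = 0 := by
    intro j hj
    obtain ⟨b, hb⟩ := hvO j
    have h1 := hgeom j
    obtain ⟨w, h2⟩ := geom_p_unit (p := q j) (he j) (hodd j) b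
    rw [show (v : RR q e) j = 1 + q j * b by rw [← hb]; ring] at h1 ⊢
    rw [← hj, h2] at h1
    rw [mul_comm _ (w : ZMod (q j ^ e j)), mul_assoc] at h1
    exact w.isUnit.mul_right_eq_zero.1 h1
  have hex : ∃ i, (v : RR q e) i - 1 ≠ 0 := by
    by_contra hno
    push Not at hno
    apply hv1
    ext1; funext i
    have := hno i
    rw [sub_eq_zero] at this
    rw [this]; rfl
  obtain ⟨i, hi⟩ := hex
  have hqi : q i = s := by
    by_contra hne; exact hi (hA i hne)
  have hei : 2 ≤ e i := by
    by_contra hlt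
    have h1 : e i = 1 := by have := he i; omega
    apply hi
    obtain ⟨b, hb⟩ := hvO i
    have h0 : (q i : ZMod (q i ^ e i)) ^ (e i) = 0 := zm_pow_self
    have h0' : (q i : ZMod (q i ^ e i)) = 0 := by
      have e2 : (q i : ZMod (q i ^ e i)) ^ e i = (q i : ZMod (q i ^ e i)) ^ 1 := by congr 1
      rw [e2, pow_one] at h0; exact h0
    rw [hb, h0', zero_mul]
  refine ⟨i, hei, ?_⟩
  intro h hh
  obtain ⟨c0, hc0⟩ := zm_dvd_of_mul (he i) 1 (by omega) _ (by simpa using hB i hqi)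
  obtain ⟨c, hc⟩ := zm_dvd_of_mul (he i) 1 (by omega) (h i) (by simpa using hh.2)
  have hpe : (q i : ZMod (q i ^ e i)) ^ (e i - 1) * q i = 0 := by
    rw [← pow_succ, show e i - 1 + 1 = e i by omega, zm_pow_self]
  have hc0u : IsUnit c0 := by
    rw [zm_isUnit_iff (he i)]
    rintro ⟨d, hd⟩
    apply hi
    rw [hc0, hd, ← mul_assoc, hpe, zero_mul]
  obtain ⟨w, rfl⟩ := hc0u
  let m : ℕ := (c * (↑w⁻¹ : ZMod (q i ^ e i))).val
  have hm : (m : ZMod (q i ^ e i)) = c * (↑w⁻¹ : ZMod (q i ^ e i)) := ZMod.natCast_zmod_val _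
  have hww : (w : ZMod (q i ^ e i)) * (↑w⁻¹ : ZMod (q i ^ e i)) = 1 := w.mul_inv
  refine ⟨v ^ m, M.pow_mem hvM m, ?_⟩
  funext j
  rw [Units.val_pow_eq_pow_val, Pi.pow_apply, Pi.add_apply, Pi.one_apply]
  by_cases hj : j = i
  · subst hj
    rw [show (v : RR q e) j = 1 + ((v : RR q e) j - 1) by ring, one_add_pow_sq_zero, hm, hc0, hc]
    · linear_combination (q j : ZMod (q j ^ e j)) ^ (e j - 1) * c * hww
    · obtain ⟨b, hb⟩ := hvO j
      conv_lhs => rw [hb, mul_assoc, mul_comm b, ← hb, ← mul_assoc, hB j hqi]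
      simp
  · have := hA j (fun hqj => hj (hinj (hqj.trans hqi.symm)))
    rw [sub_eq_zero] at this
    rw [this, one_pow, hh.1 j hj, add_zero]

/-- restriction to coordinates in `s` -/
def msk (s : Finset ι) (x : RR q e) : RR q e := fun j => if j ∈ s then x j else 0

theorem msk_add (s : Finset ι) (x y : RR q e) : msk s (x + y) = msk s x + msk s y := by
  funext j; simp only [msk, Pi.add_apply]; split_ifs <;> simp

theorem msk_compl (s : Finset ι) (x : RR q e) : msk s x + msk sᶜ x = x := by
  funext j; by_cases h : j ∈ s <;> simp [msk, h]

namespace Ctx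
theorem assoc (C : Ctx q e r) {x y : RR q e} (k : r x y) : ∃ u : (RR q e)ˣ, y = u * x :=
  assoc_of_rel C.sr C.wi C.hs C.he C.hinj C.hodd k

theorem supp (C : Ctx q e r) {x y : RR q e} (k : r x y) (j : ι) (hx : x j = 0) : y j = 0 := by
  obtain ⟨u, rfl⟩ := C.assoc k
  rw [Pi.mul_apply, hx, mul_zero]

theorem hall1 (C : Ctx q e r) (s : Finset ι) {x y : RR q e} (k : r x y) :
    r (msk s x) (msk s y) := by
  rw [← msk_compl s x] at k
  obtain ⟨a, b, ha, hb, rfl⟩ := C.sr.split k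
  convert ha using 1
  funext j
  by_cases h : j ∈ s
  · have : b j = 0 := C.supp hb j (by simp [msk, h])
    simp [msk, h, this]
  · have : a j = 0 := C.supp ha j (by simp [msk, h])
    simp [msk, h, this]

theorem hall2 (C : Ctx q e r) (s : Finset ι) {x a : RR q e} (k : r (msk s x) a) :
    ∃ c : RR q e, (∀ j ∈ s, c j = 0) ∧ r x (a + c) := by
  have h1 : msk s x = x + -(msk sᶜ x) := by
    conv_rhs => enter [1]; rw [← msk_compl s x]
    abel
  rw [h1] at k
  obtain ⟨x', c', hx, hc, rfl⟩ := C.sr.split k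
  refine ⟨-c', fun j hj => ?_, by simpa using hx⟩
  have := C.supp hc j (by simp [msk, hj])
  simp [this]

theorem pow_rel (C : Ctx q e r) (u : (RR q e)ˣ) {y : RR q e} (k : r y (u * y)) (n : ℕ) :
    r y ((u ^ n : (RR q e)ˣ) * y) := by
  induction n with
  | zero => simpa using C.sr.refl y
  | succ n ih =>
    have := C.sr.mult C.hs u ih
    rw [← mul_assoc, ← Units.val_mul, ← pow_succ'] at this
    exact C.sr.trans k this
end Ctx

/-- `y + H ⊆ [y]` -/
def PP (r : RR q e → RR q e → Prop) (i : ι) (y : RR q e) : Prop := ∀ h ∈ HH q e i, r y (y + h)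

theorem HH_mul (i : ι) (u h : RR q e) (hh : h ∈ HH q e i) : u * h ∈ HH q e i := by
  refine ⟨fun j hj => by rw [Pi.mul_apply, hh.1 j hj, mul_zero], ?_⟩
  rw [Pi.mul_apply]
  linear_combination (u i) * hh.2

theorem Ctx.P_unit (C : Ctx q e r) (i : ι) (u : (RR q e)ˣ) {y : RR q e} (k : PP r i y) :
    PP r i (u * y) := by
  intro h hh
  have := C.sr.mult C.hs u (k ((u⁻¹ : (RR q e)ˣ) * h) (HH_mul i _ h hh))
  simpa [mul_add] using this

theorem Ctx.P_mask (C : Ctx q e r) (i : ι) (s : Finset ι) (hi : i ∈ s) {y : RR q e} (k : PP r i y) :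
    PP r i (msk s y) := by
  intro h hh
  have := C.hall1 s (k h hh)
  rw [msk_add] at this
  convert this using 2
  funext j
  by_cases hj : j ∈ s
  · simp [msk, hj]
  · simp [msk, hj, hh.1 j (fun h => hj (h ▸ hi))]

theorem Ctx.sigma (C : Ctx q e r) (i : ι) (hei : 2 ≤ e i) {y : RR q e} (hy : IsUnit (y i))
    (k : PP r i (msk (Finset.univ.filter (fun j => q i ≤ q j)) y)) : PP r i y := by
  intro h hh
  obtain ⟨c, hc, hcr⟩ := C.hall2 _ (k h hh)
  set s : Finset ι := Finset.univ.filter (fun j => q i ≤ q j) with hs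
  obtain ⟨t, ht⟩ := C.assoc hcr
  let N : ℕ := ∏ j ∈ sᶜ, Nat.totient (q j ^ e j)
  have hN : Nat.Coprime N (q i) := by
    apply Nat.Coprime.prod_left
    intro j hj
    have hlt : q j < q i := by simpa [hs] using hj
    rw [Nat.totient_prime_pow (hq j).out (Nat.pos_of_ne_zero (C.he j))]
    apply Nat.Coprime.mul_left
    · apply Nat.Coprime.pow_left
      exact (Nat.coprime_primes (hq j).out (hq i).out).2 hlt.ne
    · apply Nat.Coprime.symm
      rw [Nat.Prime.coprime_iff_not_dvd (hq i).out]
      intro hd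
      have h1 := (hq j).out.two_le
      have := Nat.le_of_dvd (by omega) hd
      omega
  obtain ⟨m, hm⟩ := Nat.exists_mul_mod_eq_one_of_coprime hN (hq i).out.one_lt
  obtain ⟨m', hm'⟩ : ∃ m', N * m = 1 + q i * m' := by
    refine ⟨N * m / q i, ?_⟩
    have := Nat.mod_add_div (N * m) (q i)
    omega
  have hrel := C.pow_rel t (by rw [← ht]; exact hcr) (N * m)
  convert hrel using 1
  funext j
  rw [Units.val_pow_eq_pow_val, Pi.mul_apply, Pi.pow_apply, Pi.add_apply]
  have htj := congrFun ht j
  rw [Pi.mul_apply] at htj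
  have htu : ∀ j, IsUnit ((t : RR q e) j) := fun j => (Pi.isUnit_iff.1 t.isUnit) j
  by_cases hj : j ∈ s
  · rw [Pi.add_apply, Pi.add_apply, hc j hj, add_zero] at htj
    simp only [msk, hj, if_true] at htj
    by_cases hji : j = i
    · subst hji
      obtain ⟨w, hw⟩ := hy
      have hww : (w : ZMod (q j ^ e j)) * (↑w⁻¹ : ZMod (q j ^ e j)) = 1 := w.mul_inv
      have h1 : (t : RR q e) j = 1 + (↑w⁻¹ : ZMod (q j ^ e j)) * h j := by
        rw [← hw] at htj
        linear_combination (-(t : RR q e) j + 1) * hww - (↑w⁻¹ : ZMod (q j ^ e j)) * htj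
      obtain ⟨d, hd⟩ := zm_dvd_of_mul (C.he j) 1 (by omega) (h j) (by simpa using hh.2)
      have hsq : h j * h j = 0 := by
        obtain ⟨f, hf⟩ := dvd_pow_self (q j : ZMod (q j ^ e j)) (show e j - 1 ≠ 0 by omega)
        conv_lhs => enter [1]; rw [hd, hf]
        linear_combination (f * d) * hh.2
      rw [h1, one_add_pow_sq_zero, hm', ← hw]
      · push_cast
        linear_combination -h j * hww - (m' * (w : ZMod (q j ^ e j)) * (↑w⁻¹ : ZMod (q j ^ e j))) * hh.2
      · linear_combination ((↑w⁻¹ : ZMod (q j ^ e j)) ^ 2) * hsq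
    · rw [hh.1 j hji, add_zero] at htj ⊢
      have : ∀ k : ℕ, (t : RR q e) j ^ k * y j = y j := by
        intro k
        induction k with
        | zero => simp
        | succ k ih => rw [pow_succ, mul_assoc, ← htj, ih]
      rw [this]
  · obtain ⟨w, hw⟩ := htu j
    have hji : j ≠ i := by rintro rfl; exact hj (by simp [hs])
    have hd : Nat.totient (q j ^ e j) ∣ N * m :=
      (Finset.dvd_prod_of_mem (fun j => Nat.totient (q j ^ e j)) (by simpa using hj)).mul_right m
    obtain ⟨f, hf⟩ := hd
    have h1 : w ^ (Nat.totient (q j ^ e j)) = 1 := ZMod.pow_totient w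
    rw [hh.1 j hji, add_zero, ← hw, ← Units.val_pow_eq_pow_val, hf, pow_mul, h1]
    simp

end hall


section localring
variable {T : Type*} [CommRing T] [Fintype T] (J : Ideal T)

open Classical in
theorem sum_coset {K : Type*} [AddCommMonoid K] (f : T → K) (z : T) :
    ∑ t : T, (if t - z ∈ J then f t else 0) = ∑ φ : J, f (z + φ) := by
  rw [← Finset.sum_filter]
  refine Finset.sum_bij' (i := fun t ht => ⟨t - z, by simpa using ht⟩)
    (j := fun φ _ => z + (φ : T)) ?_ ?_ ?_ ?_ ?_
  · intro a _; simp
  · intro a _; simp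
  · intro a _; simp
  · intro a _; simp
  · intro a _; simp

open Classical in
theorem sum_coset0 {K : Type*} [AddCommMonoid K] (f : T → K) :
    ∑ t : T, (if t ∈ J then f t else 0) = ∑ φ : J, f φ := by
  have := sum_coset J f 0
  simpa using this

theorem chi_period (hJ : ∀ x, IsUnit x ↔ x ∉ J) (χ : MulChar T ℂ) (hχ : ∀ φ ∈ J, χ (1 + φ) = 1)
    (t φ : T) (hφ : φ ∈ J) : χ (t + φ) = χ t := by
  by_cases ht : IsUnit t
  · obtain ⟨u, rfl⟩ := ht
    have : (u : T) + φ = u * (1 + ↑u⁻¹ * φ) := by rw [mul_add, ← mul_assoc, u.mul_inv]; ring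
    rw [this, map_mul, hχ _ (J.mul_mem_left _ hφ), mul_one]
  · rw [χ.map_nonunit ht, χ.map_nonunit]
    rw [hJ, not_not] at ht ⊢
    exact J.add_mem ht hφ

theorem unit_add (hJ : ∀ x, IsUnit x ↔ x ∉ J) (t φ : T) (hφ : φ ∈ J) :
    IsUnit (t + φ) ↔ IsUnit t := by
  rw [hJ, hJ, J.add_mem_iff_left hφ]

open Classical in
theorem sum_one_char (hJ : ∀ x, IsUnit x ↔ x ∉ J) :
    ∑ z : T, (1 : MulChar T ℂ) z = (Fintype.card T : ℂ) - Fintype.card J := by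
  have h1 : ∀ z : T, (1 : MulChar T ℂ) z = 1 - (if z ∈ J then 1 else 0) := by
    intro z
    by_cases hz : z ∈ J
    · rw [MulChar.map_nonunit]
      · simp [hz]
      · rw [hJ]; simpa using hz
    · rw [MulChar.one_apply ((hJ z).2 hz)]; simp [hz]
  simp only [h1]
  rw [Finset.sum_sub_distrib, sum_coset0 J (fun _ => (1 : ℂ))]
  simp

open Classical in
theorem char_orth (hJ : ∀ x, IsUnit x ↔ x ∉ J) (χ : MulChar T ℂ) (hχ : ∀ φ ∈ J, χ (1 + φ) = 1)
    (hne : χ ≠ 1) (w s : T) :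
    ∑ z, χ (z - w) * χ⁻¹ (z - s) =
      -(Fintype.card J : ℂ) + (if w - s ∈ J then (Fintype.card T : ℂ) else 0) := by
  rw [← Equiv.sum_comp (Equiv.addRight s)]
  simp only [Equiv.coe_addRight, add_sub_cancel_right]
  by_cases hws : w - s ∈ J
  · have : ∀ z : T, χ (z + s - w) * χ⁻¹ z = (1 : MulChar T ℂ) z := by
      intro z
      rw [show z + s - w = z + -(w - s) by ring,
        chi_period J hJ χ hχ _ _ (J.neg_mem hws), ← MulChar.mul_apply, mul_comm, MulChar.inv_mul]
    simp only [this, sum_one_char J hJ, if_pos hws]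
    ring
  · have hd : IsUnit (s - w) := by
      rw [hJ, ← neg_sub, J.neg_mem_iff]; exact hws
    obtain ⟨d, hd⟩ := hd
    have h1 : ∀ z : T, χ (z + s - w) * χ⁻¹ z =
        if h : IsUnit z then χ (1 + d * (↑h.unit⁻¹ : T)) else 0 := by
      intro z
      split_ifs with h
      · obtain ⟨u, rfl⟩ := h
        have e1 : (u : T) + s - w = u * (1 + d * (↑u⁻¹ : T)) := by
          have := u.mul_inv
          linear_combination -(d : T) * this - hd
        have e2 : (Units.isUnit u).unit = u := by ext; simp
        rw [e2, e1, map_mul, mul_right_comm, ← MulChar.mul_apply, mul_comm χ, MulChar.inv_mul,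
          MulChar.one_apply u.isUnit, one_mul]
      · rw [MulChar.map_nonunit _ h, mul_zero]
    simp only [h1]
    have h2 : ∑ z : T, (if h : IsUnit z then χ (1 + d * (↑h.unit⁻¹ : T)) else 0) =
        ∑ y : T, (if y ∈ J then 0 else χ (1 + y)) := by
      refine Finset.sum_bij' (i := fun z _ => if h : IsUnit z then d * (↑h.unit⁻¹ : T) else z)
        (j := fun z _ => if h : IsUnit z then d * (↑h.unit⁻¹ : T) else z) (by simp) (by simp) ?_ ?_ ?_
      · intro a _
        by_cases h : IsUnit a
        · obtain ⟨u, rfl⟩ := h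
          have h3 : IsUnit ((d : T) * (↑u⁻¹ : T)) := (d * u⁻¹).isUnit
          have e2 : (Units.isUnit u).unit = u := by ext; simp
          have e3 : h3.unit = d * u⁻¹ := by ext; simp
          simp [e2, e3]
          rw [mul_left_comm, d.mul_inv, mul_one]
        · simp [h]
      · intro a _
        by_cases h : IsUnit a
        · obtain ⟨u, rfl⟩ := h
          have h3 : IsUnit ((d : T) * (↑u⁻¹ : T)) := (d * u⁻¹).isUnit
          have e2 : (Units.isUnit u).unit = u := by ext; simp
          have e3 : h3.unit = d * u⁻¹ := by ext; simp
          simp [e2, e3]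
          rw [mul_left_comm, d.mul_inv, mul_one]
        · simp [h]
      · intro a _
        by_cases h : IsUnit a
        · obtain ⟨u, rfl⟩ := h
          have h3 : IsUnit ((d : T) * (↑u⁻¹ : T)) := (d * u⁻¹).isUnit
          have h4 := (hJ _).1 h3
          have e2 : (Units.isUnit u).unit = u := by ext; simp
          simp [e2, h4]
        · have h5 : a ∈ J := by rw [hJ, not_not] at h; exact h
          simp [h, h5]
    rw [h2]
    have h3 : ∀ y : T, (if y ∈ J then 0 else χ (1 + y)) = χ (1 + y) - (if y ∈ J then χ (1 + y) else 0) := by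
      intro y; split_ifs <;> simp
    simp only [h3]
    have h6 : ∑ x, χ (1 + x) = ∑ x, χ x := Equiv.sum_comp (Equiv.addLeft (1 : T)) (fun y => χ y)
    rw [Finset.sum_sub_distrib, sum_coset0 J (fun y => χ (1 + y)), h6, MulChar.sum_eq_zero_of_ne_one hne]
    simp [hχ, hws]

open Classical in
theorem local1 (hJ : ∀ x, IsUnit x ↔ x ∉ J) (hcard : Fintype.card T ≠ 2 * Fintype.card J)
    (g : T → ℂ) (hg : (∀ x, g x ≠ 0 → IsUnit x) ∨ (∀ x, g x ≠ 0 → ¬ IsUnit x))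
    (w₀ : T) (hw₀ : ∑ φ : J, g (w₀ + φ) ≠ 0) (χ : MulChar T ℂ) (hχ : ∀ φ ∈ J, χ (1 + φ) = 1) :
    ∃ z : T, IsUnit z ∧ ∑ t, χ t * g (z - t) ≠ 0 := by
  by_contra hno
  push Not at hno
  have hJpos : (Fintype.card J : ℂ) ≠ 0 := by
    have : 0 < Fintype.card J := Fintype.card_pos
    exact_mod_cast this.ne'
  have hTpos : (Fintype.card T : ℂ) ≠ 0 := by
    have : 0 < Fintype.card T := Fintype.card_pos
    exact_mod_cast this.ne'
  have hper := chi_period J hJ χ hχ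
  set gb : T → ℂ := fun w => ∑ φ : J, g (w + φ) with hgb
  have hgbper : ∀ w, ∀ φ ∈ J, gb (w + φ) = gb w := by
    intro w φ hφ
    simp only [hgb]
    rw [← Equiv.sum_comp (Equiv.addLeft (⟨φ, hφ⟩ : J)) (fun ψ : J => g (w + ψ))]
    simp [add_assoc]
  set Fb : T → ℂ := fun z => ∑ t, χ t * gb (z - t) with hFb
  have hFbu : ∀ z, IsUnit z → Fb z = 0 := by
    intro z hz
    simp only [hFb, hgb, Finset.mul_sum]
    rw [Finset.sum_comm]
    apply Finset.sum_eq_zero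
    intro φ _
    have := hno (z + φ) ((unit_add J hJ z φ φ.2).2 hz)
    rw [← this]
    refine Finset.sum_congr rfl fun t _ => ?_
    congr 2; ring
  have hFbper : ∀ z, ∀ φ ∈ J, Fb (z + φ) = Fb z := by
    intro z φ hφ
    simp only [hFb]
    refine Finset.sum_congr rfl fun t _ => ?_
    rw [show z + φ - t = (z - t) + φ by ring, hgbper _ _ hφ]
  rcases hg with hg | hg
  · -- supported on units
    have hgb0 : ∀ w ∈ J, gb w = 0 := by
      intro w hw
      simp only [hgb]
      apply Finset.sum_eq_zero
      intro φ _
      by_contra hne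
      have := hg _ hne
      rw [hJ] at this
      exact this (J.add_mem hw φ.2)
    set S : ℂ := ∑ w, gb w with hS
    by_cases hχ1 : χ = 1
    · have h1 : ∀ z, Fb z = S - Fintype.card J * gb z := by
        intro z
        have h2 : ∀ t, χ t * gb (z - t) = gb (z - t) - (if t ∈ J then gb (z - t) else 0) := by
          intro t
          by_cases ht : t ∈ J
          · rw [MulChar.map_nonunit]
            · simp [ht]
            · rw [hJ]; simpa using ht
          · rw [hχ1, MulChar.one_apply ((hJ t).2 ht)]; simp [ht]
        simp only [hFb, h2]
        have h6 : ∑ x, gb (z - x) = S := Equiv.sum_comp (Equiv.subLeft z) gb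
        rw [Finset.sum_sub_distrib, sum_coset0 J (fun t => gb (z - t)), h6]
        congr 1
        have h3 : ∀ φ : J, gb (z - φ) = gb z := by
          intro φ; rw [sub_eq_add_neg, hgbper _ _ (J.neg_mem φ.2)]
        simp [h3]
      have h4 : ∀ z, (Fintype.card J : ℂ) * gb z = S - (if z ∈ J then S else 0) := by
        intro z
        by_cases hz : z ∈ J
        · simp [hz, hgb0 z hz]
        · have := hFbu z ((hJ z).2 hz)
          rw [h1] at this
          simp only [hz, if_false]
          linear_combination -this
      have h5 : (Fintype.card J : ℂ) * S = Fintype.card T * S - Fintype.card J * S := by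
        conv_lhs => rw [hS, Finset.mul_sum]
        simp only [h4]
        rw [Finset.sum_sub_distrib, sum_coset0 J (fun _ => S)]
        simp
      have h6 : ((Fintype.card T : ℂ) - 2 * Fintype.card J) * S = 0 := by linear_combination -h5
      have h7 : ((Fintype.card T : ℂ) - 2 * Fintype.card J) ≠ 0 := by
        rw [sub_ne_zero]; exact_mod_cast hcard
      have h8 : S = 0 := by
        rcases mul_eq_zero.1 h6 with h | h
        · exact absurd h h7
        · exact h
      have h9 := h4 w₀
      rw [h8] at h9
      simp only [ite_self, sub_zero, mul_eq_zero] at h9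
      exact h9.elim hJpos hw₀
    · have hχi : ∀ φ ∈ J, χ⁻¹ (1 + φ) = 1 := by
        intro φ hφ
        have h2 : χ (1 + φ) * χ⁻¹ (1 + φ) = 1 := by
          rw [← MulChar.mul_apply, mul_comm, MulChar.inv_mul, MulChar.one_apply]
          exact (unit_add J hJ _ _ hφ).2 isUnit_one
        rwa [hχ φ hφ, one_mul] at h2
      have hperi := chi_period J hJ χ⁻¹ hχi
      have key : ∀ s, (Fintype.card T : ℂ) * gb s - S = Fb 0 * χ⁻¹ (-s) := by
        intro s
        have e1 : ∑ z, Fb z * χ⁻¹ (z - s) = Fintype.card J * (Fb 0 * χ⁻¹ (-s)) := by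
          have : ∀ z, Fb z * χ⁻¹ (z - s) = if z ∈ J then Fb 0 * χ⁻¹ (-s) else 0 := by
            intro z
            split_ifs with hz
            · have h1 := hFbper 0 z hz
              rw [zero_add] at h1
              rw [h1, show z - s = -s + z by ring, hperi _ _ hz]
            · rw [hFbu z ((hJ z).2 hz), zero_mul]
          simp only [this]
          rw [sum_coset0 J (fun _ => Fb 0 * χ⁻¹ (-s))]
          simp
        have e2 : ∑ z, Fb z * χ⁻¹ (z - s) =
            ∑ w, gb w * ∑ z, χ (z - w) * χ⁻¹ (z - s) := by
          have : ∀ z, Fb z = ∑ w, gb w * χ (z - w) := by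
            intro z
            simp only [hFb]
            rw [← Equiv.sum_comp (Equiv.subLeft z)]
            simp [mul_comm]
          simp only [this, Finset.sum_mul, Finset.mul_sum]
          rw [Finset.sum_comm]
          simp only [mul_assoc]
        have e3 : ∑ w, gb w * ∑ z, χ (z - w) * χ⁻¹ (z - s) =
            -(Fintype.card J : ℂ) * S + Fintype.card T * (Fintype.card J * gb s) := by
          simp only [char_orth J hJ χ hχ hχ1, mul_add, Finset.sum_add_distrib, mul_ite, mul_zero]
          rw [sum_coset J (fun w => gb w * (Fintype.card T : ℂ)), ← Finset.sum_mul]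
          have h3 : ∀ φ : J, gb (s + φ) = gb s := fun φ => hgbper _ _ φ.2
          simp only [h3]
          simp [hS]
          ring
        rw [e2, e3] at e1
        have e4 : (Fintype.card J : ℂ) * ((Fintype.card T : ℂ) * gb s - S - Fb 0 * χ⁻¹ (-s)) = 0 := by
          linear_combination e1
        have := (mul_eq_zero.1 e4).resolve_left hJpos
        linear_combination this
      have hS0 : S = 0 := by
        have := key 0
        rw [hgb0 0 J.zero_mem, neg_zero] at this
        rw [MulChar.map_nonunit] at this
        · linear_combination -this
        · rw [hJ]; simp
      have hF0 : Fb 0 = 0 := by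
        have e1 : (Fintype.card T : ℂ) * Fb 0 = Fb 0 * (Fintype.card T - Fintype.card J) := by
          rw [← sum_one_char J hJ]
          conv_lhs => simp only [hFb]
          rw [Finset.mul_sum, Finset.mul_sum]
          refine Finset.sum_congr rfl fun t _ => ?_
          have := key (-t)
          rw [hS0, sub_zero, neg_neg] at this
          rw [zero_sub, ← MulChar.inv_mul χ, MulChar.mul_apply]
          linear_combination (χ t) * this
        have e2 : Fb 0 * (Fintype.card J : ℂ) = 0 := by linear_combination e1
        exact (mul_eq_zero.1 e2).resolve_right hJpos
      have := key w₀
      rw [hS0, hF0, zero_mul, sub_zero] at this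
      exact (mul_eq_zero.1 this).elim hTpos hw₀
  · -- supported on nonunits
    have hgb1 : ∀ w, w ∉ J → gb w = 0 := by
      intro w hw
      simp only [hgb]
      apply Finset.sum_eq_zero
      intro φ _
      by_contra hne
      have := hg _ hne
      rw [hJ, not_not, J.add_mem_iff_left φ.2] at this
      exact hw this
    have hw₀J : w₀ ∈ J := by
      by_contra hw
      exact hw₀ (hgb1 _ hw)
    have hgb2 : ∀ w ∈ J, gb w = gb w₀ := by
      intro w hw
      rw [← hgbper w₀ (w - w₀) (J.sub_mem hw hw₀J)]; congr 1; ring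
    have h1 := hFbu 1 isUnit_one
    have h2 : Fb 1 = Fintype.card J * gb w₀ := by
      have : ∀ t, χ t * gb (1 - t) = if t - 1 ∈ J then χ t * gb w₀ else 0 := by
        intro t
        have h3 : 1 - t ∈ J ↔ t - 1 ∈ J := by rw [← neg_sub, J.neg_mem_iff]
        split_ifs with h
        · rw [hgb2 _ (h3.2 h)]
        · rw [hgb1 _ (fun h' => h (h3.1 h')), mul_zero]
      simp only [hFb, this]
      rw [sum_coset J (fun t => χ t * gb w₀)]
      have h4 : ∀ φ : J, χ (1 + φ) = 1 := fun φ => hχ φ φ.2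
      simp [h4]
    rw [h2] at h1
    exact (mul_eq_zero.1 h1).elim hJpos hw₀

end localring


theorem mc_exists {T : Type*} [CommRing T] [Fintype T] (f : T → ℂ) (hf : f 1 ≠ 0) :
    ∃ χ : MulChar T ℂ, ∑ t, χ t * f t ≠ 0 := by
  classical
  have hfin : Fintype (MulChar T ℂ) := Fintype.ofFinite _
  by_contra hno
  push Not at hno
  have h1 : ∑ χ : MulChar T ℂ, ∑ t, χ t * f t = 0 := Finset.sum_eq_zero fun χ _ => hno χ
  rw [Finset.sum_comm] at h1
  have h2 : ∀ t : T, t ≠ 1 → ∑ χ : MulChar T ℂ, χ t = 0 := by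
    intro t ht
    obtain ⟨χ, hχ⟩ := MulChar.exists_apply_ne_one_of_hasEnoughRootsOfUnity T ℂ ht
    refine eq_zero_of_mul_eq_self_left hχ ?_
    simp only [Finset.mul_sum, ← MulChar.mul_apply]
    exact Fintype.sum_bijective _ (Group.mulLeft_bijective χ) _ _ fun χ' ↦ rfl
  simp only [← Finset.sum_mul] at h1
  rw [Finset.sum_eq_single 1] at h1
  · simp only [map_one, Finset.sum_const, Finset.card_univ, nsmul_eq_mul, mul_one] at h1
    rcases mul_eq_zero.1 h1 with h | h
    · have : 0 < Fintype.card (MulChar T ℂ) := Fintype.card_pos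
      exact this.ne' (by exact_mod_cast h)
    · exact hf h
  · intro t _ ht
    rw [h2 t ht, zero_mul]
  · simp

theorem ac_exists {T : Type*} [CommRing T] [Fintype T] (f : T → ℂ) (hf : f 0 ≠ 0) :
    ∃ θ : AddChar T ℂ, ∑ t, θ t * f t ≠ 0 := by
  classical
  by_contra hno
  push Not at hno
  have h1 : ∑ χ : AddChar T ℂ, ∑ t, χ t * f t = 0 := Finset.sum_eq_zero fun χ _ => hno χ
  rw [Finset.sum_comm] at h1
  simp only [← Finset.sum_mul, AddChar.sum_apply_eq_ite] at h1
  simp at h1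
  exact hf h1

section localring
variable {T : Type*} [CommRing T] [Fintype T] (J : Ideal T)

open Classical in
theorem gam_unique (hJ : ∀ x, IsUnit x ↔ x ∉ J) (n : ℕ) (hn : J ^ n = ⊥)
    (θ : AddChar T ℂ) (hθ : ∃ φ ∈ J, θ φ ≠ 1) (χ : MulChar T ℂ) (c c' : T)
    (h1 : ∑ s, (if s - 1 ∈ J then χ s * θ (c * (s - 1)) else 0) ≠ 0)
    (h2 : ∑ s, (if s - 1 ∈ J then χ s * θ (c' * (s - 1)) else 0) ≠ 0) : c - c' ∈ J := by
  by_contra hcc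
  have hex : ∃ j, ∀ η ∈ J ^ j, θ η = 1 := ⟨n, fun η hη => by
    rw [hn] at hη; rw [(Submodule.mem_bot T).1 hη]; simp⟩
  have hj := Nat.find_spec hex
  set k := Nat.find hex with hk
  have hk1 : 1 < k := by
    by_contra hlt
    obtain ⟨φ, hφ, hφ1⟩ := hθ
    apply hφ1
    apply hj
    have : k ≤ 1 := by omega
    exact Ideal.pow_le_pow_right this (by simpa using hφ)
  have hj' := Nat.find_min hex (m := k - 1) (by omega)
  apply hj'
  intro η₀ hη₀
  obtain ⟨d, hd⟩ := (hJ _).2 hcc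
  have key : ∀ η ∈ J ^ (k - 1), ∀ c : T,
      (∑ s, (if s - 1 ∈ J then χ s * θ (c * (s - 1)) else 0) ≠ 0) → χ (1 + η) * θ (c * η) = 1 := by
    intro η hη c hc
    have hηJ : η ∈ J := by
      have := Ideal.pow_le_pow_right (I := J) (show 1 ≤ k - 1 by omega) hη
      simpa using this
    obtain ⟨u, hu⟩ := (unit_add J hJ 1 η hηJ).2 isUnit_one
    have e1 := Equiv.sum_comp (Units.mulLeft u)
      (fun s => (if s - 1 ∈ J then χ s * θ (c * (s - 1)) else 0))
    have e2 : ∀ s, (if ((Units.mulLeft u) s) - 1 ∈ J then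
        χ ((Units.mulLeft u) s) * θ (c * (((Units.mulLeft u) s) - 1)) else 0) =
        χ (1 + η) * θ (c * η) * (if s - 1 ∈ J then χ s * θ (c * (s - 1)) else 0) := by
      intro s
      rw [Units.mulLeft_apply, hu]
      have e3 : (1 + η) * s - 1 = (s - 1) + η * s := by ring
      rw [e3, J.add_mem_iff_left (J.mul_mem_right _ hηJ)]
      split_ifs with hs
      · have e4 : c * (s - 1 + η * s) = c * (s - 1) + c * η + c * (η * (s - 1)) := by ring
        have e5 : θ (c * (η * (s - 1))) = 1 := by
          apply hj
          apply Ideal.mul_mem_left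
          have := Ideal.mul_mem_mul hη hs
          rwa [← pow_succ, Nat.sub_add_cancel (by omega)] at this
        rw [e4, AddChar.map_add_eq_mul, AddChar.map_add_eq_mul, e5, map_mul]
        ring
      · rw [mul_zero]
    simp only [e2] at e1
    rw [← Finset.mul_sum] at e1
    exact (mul_eq_right₀ hc).1 e1
  have hη : ↑d⁻¹ * η₀ ∈ J ^ (k - 1) := Ideal.mul_mem_left _ _ hη₀
  have k1 := key _ hη c h1
  have k2 := key _ hη c' h2
  have e6 : η₀ = c * (↑d⁻¹ * η₀) + - (c' * (↑d⁻¹ * η₀)) := by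
    have := d.mul_inv
    linear_combination -η₀ * this + (↑d⁻¹ * η₀) * hd
  have k3 : θ (c * (↑d⁻¹ * η₀)) = θ (c' * (↑d⁻¹ * η₀)) := by
    have hne : χ (1 + ↑d⁻¹ * η₀) ≠ 0 := fun h => by simp [h] at k1
    exact mul_left_cancel₀ hne (k1.trans k2.symm)
  rw [e6, AddChar.map_add_eq_mul, k3, ← AddChar.map_add_eq_mul]
  simp

open Classical in
theorem local2 (hJ : ∀ x, IsUnit x ↔ x ∉ J) (n : ℕ) (hn : J ^ n = ⊥) (h2 : IsUnit (2 : T))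
    (g : T → ℂ) (w₀ : T) (hw₀ : g w₀ ≠ 0) (hz : ∀ w, ∑ φ : J, g (w + φ) = 0) :
    ∃ χ₀ : MulChar T ℂ, ∀ χ : MulChar T ℂ, (∀ φ ∈ J, χ (1 + φ) = χ₀ (1 + φ)) →
      ∃ z : T, IsUnit z ∧ ∑ t, χ t * g (z - t) ≠ 0 := by
  obtain ⟨θ, hθ⟩ := ac_exists (fun x => if x ∈ J then g (w₀ + x) else 0) (by simpa using hw₀)
  simp only [mul_ite, mul_zero] at hθ
  rw [sum_coset0 J (fun x => θ x * g (w₀ + x))] at hθ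
  set gt : T → ℂ := fun w => ∑ φ : J, θ φ * g (w + φ) with hgt
  have hθ1 : ∃ φ ∈ J, θ φ ≠ 1 := by
    by_contra hno
    push Not at hno
    apply hθ
    rw [← hz w₀]
    refine Finset.sum_congr rfl fun φ _ => ?_
    rw [hno φ φ.2, one_mul]
  have hgts : ∀ w, ∀ ψ ∈ J, gt (w - ψ) = θ ψ * gt w := by
    intro w ψ hψ
    simp only [hgt]
    rw [← Equiv.sum_comp (Equiv.addLeft (⟨ψ, hψ⟩ : J)), Finset.mul_sum]
    refine Finset.sum_congr rfl fun φ _ => ?_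
    simp only [Equiv.coe_addLeft, Submodule.coe_add, AddChar.map_add_eq_mul]
    rw [mul_assoc]; congr 3; ring
  obtain ⟨t₀, ht₀, hwt⟩ : ∃ t₀ : T, IsUnit t₀ ∧ IsUnit (w₀ + t₀) := by
    by_cases hw : w₀ ∈ J
    · exact ⟨1, isUnit_one, by rw [add_comm]; exact (unit_add J hJ 1 w₀ hw).2 isUnit_one⟩
    · exact ⟨w₀, (hJ _).2 hw, by rw [← two_mul]; exact h2.mul ((hJ _).2 hw)⟩
  obtain ⟨χ₀, hχ₀⟩ := mc_exists (fun s => if s - 1 ∈ J then θ (t₀ * (s - 1)) else 0) (by simp)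
  simp only [mul_ite, mul_zero] at hχ₀
  refine ⟨χ₀, fun χ hχ => ?_⟩
  have hG0 : ∑ s, (if s - 1 ∈ J then χ s * θ (t₀ * (s - 1)) else 0) ≠ 0 := by
    convert hχ₀ using 1
    refine Finset.sum_congr rfl fun s _ => ?_
    split_ifs with hs
    · have := hχ _ hs
      rw [add_sub_cancel] at this
      rw [this]
    · rfl
  by_contra hno
  push Not at hno
  set z₀ := w₀ + t₀ with hz₀
  have hsum : ∑ t, χ t * gt (z₀ - t) = 0 := by
    simp only [hgt, Finset.mul_sum]
    rw [Finset.sum_comm]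
    apply Finset.sum_eq_zero
    intro φ _
    have := hno (z₀ + φ) ((unit_add J hJ z₀ φ φ.2).2 hwt)
    calc ∑ t, χ t * (θ φ * g (z₀ - t + φ)) = θ φ * ∑ t, χ t * g (z₀ + φ - t) := by
          rw [Finset.mul_sum]
          refine Finset.sum_congr rfl fun t _ => ?_
          rw [show z₀ - t + φ = z₀ + φ - t by ring]; ring
      _ = 0 := by rw [this, mul_zero]
  set A : T → ℂ := fun c => ∑ t, if t - c ∈ J then χ t * gt (z₀ - t) else 0 with hA
  have hAper : ∀ c c', c - c' ∈ J → A c = A c' := by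
    intro c c' hcc
    simp only [hA]
    refine Finset.sum_congr rfl fun t _ => ?_
    have : t - c ∈ J ↔ t - c' ∈ J := by
      rw [show t - c' = (t - c) + (c - c') by ring, J.add_mem_iff_left hcc]
    simp only [this]
  have hAnon : ∀ c ∈ J, A c = 0 := by
    intro c hc
    apply Finset.sum_eq_zero
    intro t _
    split_ifs with ht
    · rw [χ.map_nonunit, zero_mul]
      rw [hJ, not_not]
      have := J.add_mem ht hc
      simpa using this
    · rfl
  have hAunit : ∀ c, IsUnit c → A c = χ c * gt (z₀ - c) *
      ∑ s, (if s - 1 ∈ J then χ s * θ (c * (s - 1)) else 0) := by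
    rintro c ⟨u, rfl⟩
    simp only [hA]
    rw [← Equiv.sum_comp (Units.mulLeft u), Finset.mul_sum]
    refine Finset.sum_congr rfl fun s _ => ?_
    rw [Units.mulLeft_apply]
    have e1 : (u : T) * s - u ∈ J ↔ s - 1 ∈ J := by
      constructor
      · intro h
        have := J.mul_mem_left (↑u⁻¹) h
        rwa [← mul_sub_one, ← mul_assoc, u.inv_mul, one_mul] at this
      · intro h
        rw [← mul_sub_one]; exact J.mul_mem_left _ h
    simp only [e1]
    split_ifs with hs
    · rw [show z₀ - u * s = (z₀ - u) - u * (s - 1) by ring,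
        hgts _ _ (J.mul_mem_left _ hs), map_mul]
      ring
    · rw [mul_zero]
  have hAt0 : A t₀ ≠ 0 := by
    rw [hAunit _ ht₀]
    refine mul_ne_zero (mul_ne_zero ?_ ?_) hG0
    · obtain ⟨u, rfl⟩ := ht₀
      intro h0
      have : χ u * χ (↑u⁻¹) = 1 := by rw [← map_mul, u.mul_inv, map_one]
      rw [h0, zero_mul] at this
      exact zero_ne_one this
    · rw [hz₀, add_sub_cancel_right]; exact hθ
  have hAc : ∀ c, A c = if c - t₀ ∈ J then A t₀ else 0 := by
    intro c
    split_ifs with h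
    · exact hAper _ _ h
    · by_contra hne
      have hcu : IsUnit c := by
        rw [hJ]; intro hc; exact hne (hAnon c hc)
      rw [hAunit c hcu] at hne
      exact h (gam_unique J hJ n hn θ hθ1 χ c t₀ (right_ne_zero_of_mul hne) hG0)
  have s1 : ∑ c, A c = Fintype.card J * A t₀ := by
    rw [Finset.sum_congr rfl fun c _ => hAc c, sum_coset J (fun _ => A t₀)]
    simp
  have s2 : ∑ c, A c = Fintype.card J * ∑ t, χ t * gt (z₀ - t) := by
    simp only [hA]
    rw [Finset.sum_comm, Finset.mul_sum]
    refine Finset.sum_congr rfl fun t _ => ?_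
    have : ∀ c, t - c ∈ J ↔ c - t ∈ J := fun c => by rw [← neg_sub, J.neg_mem_iff]
    simp only [this]
    rw [sum_coset J (fun _ => χ t * gt (z₀ - t))]
    simp
  rw [s1, hsum, mul_zero] at s2
  rcases mul_eq_zero.1 s2 with h | h
  · have : 0 < Fintype.card J := Fintype.card_pos
    exact this.ne' (by exact_mod_cast h)
  · exact hAt0 h

theorem localL (hJ : ∀ x, IsUnit x ↔ x ∉ J) (n : ℕ) (hn : J ^ n = ⊥) (h2 : IsUnit (2 : T))
    (hcard : Nat.card T ≠ 2 * Nat.card J) (g : T → ℂ)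
    (hg : (∀ x, g x ≠ 0 → IsUnit x) ∨ (∀ x, g x ≠ 0 → ¬ IsUnit x)) (w₀ : T) (hw₀ : g w₀ ≠ 0) :
    ∃ χ₀ : MulChar T ℂ, ∀ χ : MulChar T ℂ, (∀ φ ∈ J, χ (1 + φ) = χ₀ (1 + φ)) →
      ∃ z : T, IsUnit z ∧ ∑ t, χ t * g (z - t) ≠ 0 := by
  classical
  by_cases hz : ∀ w, ∑ φ : J, g (w + φ) = 0
  · exact local2 J hJ n hn h2 g w₀ hw₀ hz
  · push Not at hz
    obtain ⟨w, hw⟩ := hz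
    refine ⟨1, fun χ hχ => ?_⟩
    have hcard' : Fintype.card T ≠ 2 * Fintype.card J := by
      simpa only [Nat.card_eq_fintype_card] using hcard
    refine local1 J hJ hcard' g hg w hw χ fun φ hφ => ?_
    rw [hχ φ hφ, MulChar.one_apply ((unit_add J hJ 1 φ hφ).2 isUnit_one)]

end localring

theorem localZ (p e : ℕ) [hp : Fact p.Prime] (he : e ≠ 0) (hp2 : p ≠ 2) (g : ZMod (p ^ e) → ℂ)
    (hg : (∀ x, g x ≠ 0 → IsUnit x) ∨ (∀ x, g x ≠ 0 → ¬ IsUnit x)) (w₀ : ZMod (p ^ e))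
    (hw₀ : g w₀ ≠ 0) :
    ∃ χ₀ : MulChar (ZMod (p ^ e)) ℂ, ∀ χ : MulChar (ZMod (p ^ e)) ℂ,
      (∀ φ, (p : ZMod (p ^ e)) ∣ φ → χ (1 + φ) = χ₀ (1 + φ)) →
      ∃ z, IsUnit z ∧ ∑ t, χ t * g (z - t) ≠ 0 := by
  have hJ : ∀ x, IsUnit x ↔ x ∉ Ideal.span {(p : ZMod (p ^ e))} := by
    intro x; rw [Ideal.mem_span_singleton]; exact zm_isUnit_iff he x
  have hodd : Odd p := hp.out.odd_of_ne_two hp2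
  have h2 : IsUnit (2 : ZMod (p ^ e)) := by
    have := (ZMod.isUnit_iff_coprime 2 (p ^ e)).2
      (Nat.Coprime.pow_right e ((Nat.coprime_two_left).2 hodd))
    simpa using this
  have hn : (Ideal.span {(p : ZMod (p ^ e))}) ^ e = ⊥ := by
    rw [Ideal.span_singleton_pow, Ideal.span_singleton_eq_bot]
    exact_mod_cast ZMod.natCast_self (p ^ e)
  obtain ⟨χ₀, h⟩ := localL (Ideal.span {(p : ZMod (p ^ e))}) hJ e hn h2 (by
    rw [Nat.card_zmod]
    intro h
    have h3 : (2 : ℕ) ∣ p ^ e := ⟨_, h⟩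
    have := (hodd.pow (n := e))
    exact (Nat.not_even_iff_odd.2 this) (even_iff_two_dvd.2 h3)) g hg w₀ hw₀
  refine ⟨χ₀, fun χ hχ => h χ fun φ hφ => hχ φ ?_⟩
  rwa [Ideal.mem_span_singleton] at hφ


theorem char_ext {A : Type*} [CommGroup A] [Finite A] (M O : Subgroup A)
    (hMO : ∀ u ∈ M, u ∈ O → u = 1) (L : A →* ℂˣ) :
    ∃ l : A →* ℂˣ, (∀ u ∈ O, l u = L u) ∧ (∀ u ∈ M, l u = 1) := by
  let f : O →* A ⧸ M := (QuotientGroup.mk' M).comp O.subtype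
  have hf : Function.Injective f := by
    rw [injective_iff_map_eq_one]
    intro a ha
    have : (a : A) ∈ M := by
      simpa [f, QuotientGroup.eq_one_iff] using ha
    exact Subtype.ext (hMO _ this a.2)
  let E := MonoidHom.ofInjective hf
  let ψ : f.range →* ℂˣ := (L.comp O.subtype).comp E.symm.toMonoidHom
  obtain ⟨l, hl⟩ := MonoidHom.domRestrict_surjective ℂ f.range ψ
  refine ⟨l.comp (QuotientGroup.mk' M), ?_, ?_⟩
  · intro u hu
    have h1 := DFunLike.congr_fun hl (E ⟨u, hu⟩)
    simp only [ψ, MonoidHom.comp_apply] at h1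
    have h2 : E.symm.toMonoidHom (E ⟨u, hu⟩) = ⟨u, hu⟩ := E.symm_apply_apply _
    rw [h2] at h1
    exact h1
  · intro u hu
    have : (QuotientGroup.mk' M) u = 1 := by simpa [QuotientGroup.eq_one_iff] using hu
    rw [MonoidHom.comp_apply, this, map_one]

section F
variable {ι : Type*} [Fintype ι] [DecidableEq ι] {q e : ι → ℕ} [hq : ∀ i, Fact (q i).Prime]

noncomputable def usingle (i : ι) : (ZMod (q i ^ e i))ˣ →* (RR q e)ˣ :=
  Units.map (MonoidHom.mulSingle (fun i => ZMod (q i ^ e i)) i)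

theorem usingle_apply (i : ι) (u : (ZMod (q i ^ e i))ˣ) :
    ((usingle i u : (RR q e)ˣ) : RR q e) = Pi.mulSingle i (u : ZMod (q i ^ e i)) := rfl

noncomputable def ucomp (u : (RR q e)ˣ) (i : ι) : (ZMod (q i ^ e i))ˣ :=
  Units.map (Pi.evalMonoidHom (fun i => ZMod (q i ^ e i)) i) u

theorem ucomp_apply (u : (RR q e)ˣ) (i : ι) : (ucomp u i : ZMod (q i ^ e i)) = (u : RR q e) i := rfl

theorem prod_usingle (u : (RR q e)ˣ) : ∏ i, usingle i (ucomp u i) = u := by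
  ext1
  rw [Units.coe_prod]
  simp only [usingle_apply, ucomp_apply]
  exact Finset.univ_prod_mulSingle (u : RR q e)

noncomputable def mcomp (l : (RR q e)ˣ →* ℂˣ) (i : ι) : MulChar (ZMod (q i ^ e i)) ℂ :=
  MulChar.ofUnitHom (l.comp (usingle i))

theorem mcomp_apply (l : (RR q e)ˣ →* ℂˣ) (i : ι) (u : (ZMod (q i ^ e i))ˣ) :
    mcomp l i u = (l (usingle i u) : ℂ) := by
  simp [mcomp, MulChar.ofUnitHom_coe]

theorem mcomp_prod (l : (RR q e)ˣ →* ℂˣ) (t : RR q e) :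
    MulChar.ofUnitHom l t = ∏ i, mcomp l i (t i) := by
  by_cases ht : IsUnit t
  · obtain ⟨u, rfl⟩ := ht
    have h : ∀ i, mcomp l i ((u : RR q e) i) = (l (usingle i (ucomp u i)) : ℂ) := by
      intro i; rw [← mcomp_apply, ucomp_apply]
    simp only [h]
    rw [← Units.coe_prod, ← map_prod, prod_usingle, MulChar.ofUnitHom_coe]
  · rw [MulChar.map_nonunit _ ht]
    have : ∃ i, ¬ IsUnit (t i) := by
      by_contra hno
      push Not at hno
      exact ht (Pi.isUnit_iff.2 hno)
    obtain ⟨i, hi⟩ := this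
    have h0 : mcomp l i (t i) = 0 := MulChar.map_nonunit _ hi
    exact (Finset.prod_eq_zero (Finset.mem_univ i) h0).symm

open Classical in
theorem lemF (he : ∀ i, e i ≠ 0) (hodd : ∀ i, q i ≠ 2) (M : Subgroup (RR q e)ˣ)
    (hM : ∀ u ∈ M, u ∈ Om q e → u = 1) (δ : RR q e → ℂ)
    (hsupp : ∀ w w', δ w ≠ 0 → δ w' ≠ 0 → ∃ u : (RR q e)ˣ, w' = u * w)
    (hstar : ∀ z t : (RR q e)ˣ, ∑ u : (RR q e)ˣ,
      (if u ∈ M then δ (z + u * t) else 0) = 0) : ∀ w, δ w = 0 := by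
  by_contra hno
  push Not at hno
  obtain ⟨w₀, hw₀⟩ := hno
  obtain ⟨κ, hκ⟩ := mc_exists (fun t => δ (t * w₀)) (by simpa using hw₀)
  set dk : RR q e → ℂ := fun w => ∑ t, κ t * δ (t * w) with hdk
  have hc : dk w₀ ≠ 0 := hκ
  have hdku : ∀ (u : (RR q e)ˣ) w, κ u * dk (u * w) = dk w := by
    intro u w
    simp only [hdk]
    rw [Finset.mul_sum, ← Equiv.sum_comp (Units.mulLeft u) (fun t => κ t * δ (t * w))]
    refine Finset.sum_congr rfl fun t _ => ?_
    rw [Units.mulLeft_apply, map_mul]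
    rw [show t * (u * w) = u * t * w by ring]; ring
  have hκu : ∀ u : (RR q e)ˣ, κ u ≠ 0 := by
    intro u h0
    have : κ u * κ (↑u⁻¹) = 1 := by rw [← map_mul, u.mul_inv, map_one]
    rw [h0, zero_mul] at this
    exact zero_ne_one this
  have hdks : ∀ w, dk w ≠ 0 → ∃ v : (RR q e)ˣ, w = v * w₀ := by
    intro w hw
    obtain ⟨t, _, ht⟩ := Finset.exists_ne_zero_of_sum_ne_zero hw
    have h1 : IsUnit t := by
      by_contra h
      rw [MulChar.map_nonunit _ h, zero_mul] at ht
      exact ht rfl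
    obtain ⟨t, rfl⟩ := h1
    obtain ⟨u, hu⟩ := hsupp w₀ _ hw₀ (right_ne_zero_of_mul ht)
    refine ⟨t⁻¹ * u, ?_⟩
    rw [Units.val_mul, mul_assoc, ← hu, ← mul_assoc, t.inv_mul, one_mul]
  set g : ∀ i, ZMod (q i ^ e i) → ℂ := fun i x => dk (Function.update w₀ i x) / dk w₀ with hg
  have hupd : ∀ i (u : (ZMod (q i ^ e i))ˣ),
      Function.update w₀ i (u * w₀ i) = (usingle i u : (RR q e)ˣ) * w₀ := by
    intro i u
    funext j
    rw [Pi.mul_apply, usingle_apply]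
    by_cases hj : j = i
    · subst hj; simp
    · simp [hj]
  have hgu : ∀ i (u : (ZMod (q i ^ e i))ˣ), κ (usingle i u : (RR q e)ˣ) * g i (u * w₀ i) = 1 := by
    intro i u
    simp only [hg]
    rw [hupd, mul_div_assoc', hdku, div_self hc]
  have hgs : ∀ i x, g i x ≠ 0 → ∃ u : (ZMod (q i ^ e i))ˣ, x = u * w₀ i := by
    intro i x hx
    have h1 : dk (Function.update w₀ i x) ≠ 0 := fun h => hx (by simp [hg, h])
    obtain ⟨v, hv⟩ := hdks _ h1
    refine ⟨ucomp v i, ?_⟩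
    have := congrFun hv i
    simpa [ucomp_apply] using this
  have hprod : ∀ w, dk w = dk w₀ * ∏ i, g i (w i) := by
    intro w
    by_cases hw : ∀ i, ∃ u : (ZMod (q i ^ e i))ˣ, w i = u * w₀ i
    · choose v hv using hw
      let V : (RR q e)ˣ := ∏ i, usingle i (v i)
      have hV : (V : RR q e) = fun i => (v i : ZMod (q i ^ e i)) := by
        simp only [V]
        rw [Units.coe_prod]
        simp only [usingle_apply]
        exact Finset.univ_prod_mulSingle _
      have hw : w = V * w₀ := by
        funext i; rw [hV, Pi.mul_apply, hv i]
      have h2 : κ V * (∏ i, g i (w i)) = 1 := by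
        have : κ V = ∏ i, κ (usingle i (v i) : (RR q e)ˣ) := by
          simp only [V]; rw [Units.coe_prod, map_prod]
        rw [this, ← Finset.prod_mul_distrib]
        apply Finset.prod_eq_one
        intro i _
        rw [hv i, hgu]
      apply mul_left_cancel₀ (hκu V)
      rw [mul_left_comm, h2, mul_one, hw, hdku]
    · push Not at hw
      obtain ⟨i, hi⟩ := hw
      have h1 : g i (w i) = 0 := by
        by_contra h
        obtain ⟨u, hu⟩ := hgs i _ h
        exact hi u hu
      rw [Finset.prod_eq_zero (Finset.mem_univ i) h1, mul_zero]
      by_contra h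
      obtain ⟨v, hv⟩ := hdks w h
      refine hi (ucomp v i) ?_
      have := congrFun hv i
      simpa [ucomp_apply] using this
  have hloc : ∀ i, ∃ χ₀ : MulChar (ZMod (q i ^ e i)) ℂ, ∀ χ : MulChar (ZMod (q i ^ e i)) ℂ,
      (∀ φ, (q i : ZMod (q i ^ e i)) ∣ φ → χ (1 + φ) = χ₀ (1 + φ)) →
      ∃ z, IsUnit z ∧ ∑ t, χ t * g i (z - t) ≠ 0 := by
    intro i
    refine localZ (q i) (e i) (he i) (hodd i) (g i) ?_ (w₀ i) ?_
    · by_cases h : IsUnit (w₀ i)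
      · left
        intro x hx
        obtain ⟨u, rfl⟩ := hgs i x hx
        exact u.isUnit.mul h
      · right
        intro x hx
        obtain ⟨u, rfl⟩ := hgs i x hx
        rwa [Units.isUnit_units_mul]
    · simp only [hg, Function.update_eq_self]
      rw [div_self hc]; exact one_ne_zero
  choose χ₀ hχ₀ using hloc
  let L : (RR q e)ˣ →* ℂˣ := ∏ i, ((χ₀ i).toUnitHom.comp
    (Units.map (Pi.evalMonoidHom (fun i => ZMod (q i ^ e i)) i)))
  have hL : ∀ u, (L u : ℂ) = ∏ i, χ₀ i ((u : RR q e) i) := by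
    intro u
    simp only [L, MonoidHom.finset_prod_apply, Units.coe_prod]
    refine Finset.prod_congr rfl fun i _ => ?_
    rw [MonoidHom.comp_apply, MulChar.coe_toUnitHom]
    rfl
  obtain ⟨l, hlO, hlM⟩ := char_ext M (Om q e) hM L
  have hz : ∀ i, ∃ z, IsUnit z ∧ ∑ t, mcomp l i t * g i (z - t) ≠ 0 := by
    intro i
    apply hχ₀
    intro φ hφ
    have hu : IsUnit (1 + φ) := by
      rw [zm_isUnit_iff (he i)]
      intro h
      have h1 : (q i : ZMod (q i ^ e i)) ∣ 1 := (dvd_add_left hφ).1 h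
      exact (zm_isUnit_iff (he i) 1).1 isUnit_one h1
    obtain ⟨u, hu⟩ := hu
    rw [← hu, mcomp_apply, hlO, hL]
    · rw [Finset.prod_eq_single i]
      · simp [usingle_apply]
      · intro j _ hj
        simp [usingle_apply, hj]
      · simp
    · intro j
      rw [usingle_apply]
      by_cases hj : j = i
      · subst hj; simp [hu, hφ]
      · simp [hj]
  choose z hzu hz using hz
  obtain ⟨Z, hZ⟩ : IsUnit (z : RR q e) := Pi.isUnit_iff.2 hzu
  have hne : ∑ t : RR q e, MulChar.ofUnitHom l t * dk (z - t) ≠ 0 := by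
    have h1 : ∑ t : RR q e, MulChar.ofUnitHom l t * dk (z - t) =
        dk w₀ * ∏ i, ∑ x, mcomp l i x * g i (z i - x) := by
      rw [Finset.prod_univ_sum, Fintype.piFinset_univ, Finset.mul_sum]
      refine Finset.sum_congr rfl fun t _ => ?_
      rw [mcomp_prod, hprod, Finset.prod_mul_distrib]
      simp only [Pi.sub_apply]
      ring
    rw [h1]
    exact mul_ne_zero hc (Finset.prod_ne_zero_iff.2 fun i _ => hz i)
  apply hne
  have hshift : ∀ a ∈ M, ∑ t : RR q e, MulChar.ofUnitHom l t * dk (z - a * t) =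
      ∑ t : RR q e, MulChar.ofUnitHom l t * dk (z - t) := by
    intro a ha
    rw [← Equiv.sum_comp (Units.mulLeft a) (fun t => MulChar.ofUnitHom l t * dk (z - t))]
    refine Finset.sum_congr rfl fun t _ => ?_
    rw [Units.mulLeft_apply, map_mul, MulChar.ofUnitHom_coe, hlM a ha, Units.val_one, one_mul]
  have hdz : ∀ t : RR q e, IsUnit t → ∑ a : (RR q e)ˣ, (if a ∈ M then dk (z - a * t) else 0) = 0 := by
    rintro t ⟨t, rfl⟩
    simp only [hdk]
    have h1 : ∀ a : (RR q e)ˣ, (if a ∈ M then ∑ s, κ s * δ (s * (z - a * t)) else 0) =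
        ∑ s, κ s * (if a ∈ M then δ (s * (z - a * t)) else 0) := by
      intro a; split_ifs <;> simp
    simp only [h1]
    rw [Finset.sum_comm]
    apply Finset.sum_eq_zero
    intro s _
    by_cases hs : IsUnit s
    · obtain ⟨s, rfl⟩ := hs
      rw [← Finset.mul_sum]
      have h2 := hstar (s * Z) (-(s * t))
      have h3 : ∀ a : (RR q e)ˣ, (s : RR q e) * (z - a * t) =
          ((s * Z : (RR q e)ˣ) : RR q e) + a * ((-(s * t) : (RR q e)ˣ) : RR q e) := by
        intro a
        rw [Units.val_mul, Units.val_neg, Units.val_mul, hZ]; ring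
      simp only [h3]
      rw [h2, mul_zero]
    · simp [MulChar.map_nonunit _ hs]
  have h5 : ∑ a : (RR q e)ˣ, (if a ∈ M then
      ∑ t : RR q e, MulChar.ofUnitHom l t * dk (z - a * t) else 0) = 0 := by
    have h1 : ∀ a : (RR q e)ˣ, (if a ∈ M then
        ∑ t : RR q e, MulChar.ofUnitHom l t * dk (z - a * t) else 0) =
        ∑ t : RR q e, MulChar.ofUnitHom l t * (if a ∈ M then dk (z - a * t) else 0) := by
      intro a; split_ifs <;> simp
    simp only [h1]
    rw [Finset.sum_comm]
    apply Finset.sum_eq_zero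
    intro t _
    rw [← Finset.mul_sum]
    by_cases ht : IsUnit t
    · rw [hdz t ht, mul_zero]
    · rw [MulChar.map_nonunit _ ht, zero_mul]
  have h6 : ∀ a : (RR q e)ˣ, (if a ∈ M then
      ∑ t : RR q e, MulChar.ofUnitHom l t * dk (z - a * t) else 0) =
      (if a ∈ M then 1 else 0) * ∑ t : RR q e, MulChar.ofUnitHom l t * dk (z - t) := by
    intro a
    split_ifs with ha
    · rw [hshift a ha, one_mul]
    · rw [zero_mul]
  simp only [h6] at h5
  rw [← Finset.sum_mul] at h5
  refine (mul_eq_zero.1 h5).resolve_left ?_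
  rw [Finset.sum_boole]
  have : 0 < (Finset.univ.filter (fun a => a ∈ M)).card :=
    Finset.card_pos.2 ⟨1, by simp [M.one_mem]⟩
  exact_mod_cast this.ne'

end F


open Classical in
theorem SR.transl {R : Type*} [AddCommGroup R] [Fintype R] {r : R → R → Prop} (h : SR r)
    (f : R → ℂ) (hf : CF r f) (x₀ : R) :
    CF r (fun Z => ∑ x, if r x₀ x then f (Z + x) else 0) := by
  have hcf : CF r (fun x => if r (-x₀) x then (1 : ℂ) else 0) := by
    intro x y hxy
    have : r (-x₀) x ↔ r (-x₀) y := ⟨fun k => h.trans k hxy, fun k => h.trans k (h.symm hxy)⟩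
    simp only [this]
  have := h.conv _ f hcf hf
  intro z z' hz
  have h2 : ∀ Z, (∑ x, if r x₀ x then f (Z + x) else 0) =
      ∑ x, (if r (-x₀) x then (1 : ℂ) else 0) * f (Z - x) := by
    intro Z
    rw [← Equiv.sum_comp (Equiv.neg R)]
    refine Finset.sum_congr rfl fun x _ => ?_
    have h3 : r x₀ (-x) ↔ r (-x₀) x :=
      ⟨fun k => by simpa using h.neg _ _ k, fun k => by simpa using h.neg _ _ k⟩
    simp only [Equiv.neg_apply, h3, ite_mul, one_mul, zero_mul, ← sub_eq_add_neg]
  simp only [h2]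
  exact this z z' hz

open Classical in
theorem sum_reindex {R A : Type*} [Fintype R] [Fintype A] (Q : R → Prop) (P : A → Prop)
    (φ : A → R) (hφ : Function.Injective φ) (hQ : ∀ x, Q x ↔ ∃ a, P a ∧ x = φ a) (f : R → ℂ) :
    (∑ a, if P a then f (φ a) else 0) = ∑ x, if Q x then f x else 0 := by
  rw [← Finset.sum_filter, ← Finset.sum_filter]
  refine Finset.sum_bij (fun a _ => φ a) ?_ ?_ ?_ ?_
  · intro a ha; simp only [Finset.mem_filter, Finset.mem_univ, true_and] at ha ⊢
    exact (hQ _).2 ⟨a, ha, rfl⟩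
  · intro a _ b _ hab; exact hφ hab
  · intro x hx
    simp only [Finset.mem_filter, Finset.mem_univ, true_and] at hx
    obtain ⟨a, ha, rfl⟩ := (hQ x).1 hx
    exact ⟨a, by simpa using ha, rfl⟩
  · intro a _; rfl

section A
variable {ι : Type*} [Fintype ι] [DecidableEq ι] {q e : ι → ℕ} [hq : ∀ i, Fact (q i).Prime]
  {r : RR q e → RR q e → Prop}

/-- the stabilizer-type group of the unit class -/
def Ctx.MM (C : Ctx q e r) : Subgroup (RR q e)ˣ where
  carrier := {u | r 1 u}
  one_mem' := C.sr.refl 1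
  mul_mem' := by
    intro a b ha hb
    have := C.sr.mult C.hs a hb
    rw [mul_one] at this
    exact C.sr.trans ha this
  inv_mem' := by
    intro a ha
    have := C.sr.mult C.hs a⁻¹ ha
    rw [mul_one, a.inv_mul] at this
    exact C.sr.symm this

theorem Ctx.mem_MM (C : Ctx q e r) (u : (RR q e)ˣ) : u ∈ C.MM ↔ r 1 u := Iff.rfl

/-- restricted coordinates -/
abbrev RS (q e : ι → ℕ) (t : Finset ι) := RR (fun j : {j // j ∈ t} => q j) (fun j => e j)

def ext0 (t : Finset ι) (b : RR q e) (w : RS q e t) : RR q e :=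
  fun j => if h : j ∈ t then w ⟨j, h⟩ else b j

def resC (t : Finset ι) (x : RR q e) : RS q e t := fun j => x j

theorem ext0_mem (t : Finset ι) (b : RR q e) (w : RS q e t) (j : ι) (h : j ∈ t) :
    ext0 t b w j = w ⟨j, h⟩ := by simp [ext0, h]

theorem ext0_not (t : Finset ι) (b : RR q e) (w : RS q e t) (j : ι) (h : j ∉ t) :
    ext0 t b w j = b j := by simp [ext0, h]

theorem resC_ext0 (t : Finset ι) (b : RR q e) (w : RS q e t) : resC t (ext0 t b w) = w := by
  funext j; simp [resC, ext0]

theorem ext0_inj (t : Finset ι) (b : RR q e) : Function.Injective (ext0 t b) := by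
  intro x y h
  rw [← resC_ext0 t b x, h, resC_ext0]

theorem ext0_add (t : Finset ι) (b b' : RR q e) (w w' : RS q e t) :
    ext0 t (b + b') (w + w') = ext0 t b w + ext0 t b' w' := by
  funext j; by_cases h : j ∈ t <;> simp [ext0, h]

theorem ext0_mul (t : Finset ι) (b b' : RR q e) (w w' : RS q e t) :
    ext0 t (b * b') (w * w') = ext0 t b w * ext0 t b' w' := by
  funext j; by_cases h : j ∈ t <;> simp [ext0, h]

theorem ext0_one (t : Finset ι) : ext0 t (1 : RR q e) 1 = 1 := by
  funext j; by_cases h : j ∈ t <;> simp [ext0, h]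

def extU (t : Finset ι) (u : (RS q e t)ˣ) : (RR q e)ˣ where
  val := ext0 t 1 u
  inv := ext0 t 1 (u⁻¹ : (RS q e t)ˣ)
  val_inv := by rw [← ext0_mul, u.mul_inv, mul_one, ext0_one]
  inv_val := by rw [← ext0_mul, u.inv_mul, mul_one, ext0_one]

theorem extU_val (t : Finset ι) (u : (RS q e t)ˣ) : (extU t u : RR q e) = ext0 t 1 u := rfl

theorem extU_mul (t : Finset ι) (u : (RS q e t)ˣ) (w : RS q e t) :
    (extU t u : RR q e) * ext0 t 0 w = ext0 t 0 ((u : RS q e t) * w) := by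
  rw [extU_val, ← ext0_mul, mul_zero]

def resU (t : Finset ι) (u : (RR q e)ˣ) : (RS q e t)ˣ where
  val := resC t u
  inv := resC t (u⁻¹ : (RR q e)ˣ)
  val_inv := by
    funext j; have := congrFun u.mul_inv j; simpa [resC] using this
  inv_val := by
    funext j; have := congrFun u.inv_mul j; simpa [resC] using this

theorem resU_val (t : Finset ι) (u : (RR q e)ˣ) : (resU t u : RS q e t) = resC t u := rfl

/-- the group of the unit class on restricted coordinates -/
def Ctx.MC (C : Ctx q e r) (t : Finset ι) : Subgroup (RS q e t)ˣ where
  carrier := {u | r (ext0 t 0 1) (ext0 t 0 u)}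
  one_mem' := C.sr.refl _
  mul_mem' := by
    intro a b ha hb
    have := C.sr.mult C.hs (extU t a) hb
    rw [extU_mul, extU_mul, mul_one] at this
    exact C.sr.trans ha this
  inv_mem' := by
    intro a ha
    have := C.sr.mult C.hs (extU t a⁻¹) ha
    rw [extU_mul, extU_mul, mul_one, a.inv_mul] at this
    exact C.sr.symm this

theorem Ctx.mem_MC (C : Ctx q e r) (t : Finset ι) (u : (RS q e t)ˣ) :
    u ∈ C.MC t ↔ r (ext0 t 0 1) (ext0 t 0 u) := Iff.rfl

theorem Ctx.hE (C : Ctx q e r) (t : Finset ι) (s : (RS q e t)ˣ) (x : RR q e) :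
    r (ext0 t 0 s) x ↔ ∃ a, a ∈ C.MC t ∧ x = ext0 t 0 ((a : RS q e t) * (s : RS q e t)) := by
  constructor
  · intro h
    obtain ⟨u, rfl⟩ := C.assoc h
    have hx : (u : RR q e) * ext0 t 0 s = ext0 t 0 ((resU t u : RS q e t) * (s : RS q e t)) := by
      funext j; by_cases hj : j ∈ t <;> simp [ext0, hj, resU_val, resC]
    refine ⟨resU t u, ?_, hx⟩
    rw [hx] at h
    have := C.sr.mult C.hs (extU t s⁻¹) h
    rw [extU_mul, extU_mul, s.inv_mul, mul_left_comm, s.inv_mul, mul_one] at this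
    exact this
  · rintro ⟨a, ha, rfl⟩
    have := C.sr.mult C.hs (extU t s) ha
    rw [extU_mul, extU_mul, mul_one, mul_comm] at this
    exact this

theorem Ctx.MC_triv (C : Ctx q e r) (i₀ : ι) (hmax : ∀ j, 2 ≤ e j → PP r j 1 → q j ≤ q i₀)
    (t : Finset ι) (ht : ∀ j, j ∈ t ↔ q i₀ < q j) (u : (RS q e t)ˣ) (hu : u ∈ C.MC t)
    (huO : u ∈ Om (fun j : {j // j ∈ t} => q j) (fun j => e j)) : u = 1 := by
  by_contra hu1
  obtain ⟨j, hej, hj⟩ := f2 (q := fun j : {j // j ∈ t} => q j) (e := fun j => e j)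
    (fun j => C.he j) (fun a b hab => Subtype.ext (C.hinj hab)) (fun j => C.hodd j) (C.MC t) u hu hu1 huO
  have hjt : q i₀ < q j := (ht j).1 j.2
  have h1 : PP r (j : ι) (ext0 t 0 1) := by
    intro h hh
    obtain ⟨v, hv, hv1⟩ := hj (resC t h) ⟨fun k hk => hh.1 k (fun h' => hk (Subtype.ext h')), hh.2⟩
    rw [C.mem_MC, hv1] at hv
    have h2 : ext0 t 0 (1 + resC t h) = ext0 t 0 1 + h := by
      funext k
      by_cases hk : k ∈ t
      · simp [ext0, hk, resC]
      · have : k ≠ j := fun h' => hk (h' ▸ j.2)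
        simp [ext0, hk, hh.1 k this]
    rwa [h2] at hv
  have h3 : PP r (j : ι) 1 := by
    refine C.sigma j hej isUnit_one ?_
    have h4 := C.P_mask j (Finset.univ.filter (fun k => q j ≤ q k)) (by simp) h1
    convert h4 using 1
    funext k
    by_cases hk : q j ≤ q k
    · have hkt : k ∈ t := by rw [ht]; omega
      simp [msk, hk, ext0, hkt]
    · simp [msk, hk]
  have := hmax j hej h3
  omega

theorem Ctx.P_all (C : Ctx q e r) (i₀ : ι) (hei : 2 ≤ e i₀) (h1 : PP r i₀ 1)
    (hmax : ∀ j, 2 ≤ e j → PP r j 1 → q j ≤ q i₀) (y : RR q e) (hy : IsUnit (y i₀)) : PP r i₀ y := by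
  classical
  intro h hh
  set t := Finset.univ.filter (fun j => q i₀ < q j) with ht
  have hi₀ : i₀ ∉ t := by simp [ht]
  have hht : ∀ j ∈ t, h j = 0 := fun j hj => hh.1 j (fun h' => hi₀ (h' ▸ hj))
  let Y : RR q e → ℂ := fun x => if r y x then 1 else 0
  have hY : CF r Y := by
    intro a b hab
    have : r y a ↔ r y b := ⟨fun k => C.sr.trans k hab, fun k => C.sr.trans k (C.sr.symm hab)⟩
    simp only [Y, this]
  let δ : RS q e t → ℂ := fun w => Y (ext0 t y w) - Y (ext0 t y w + h)
  have hs0 : ∀ w, δ w ≠ 0 → ∃ u : (RS q e t)ˣ, w = u * resC t y := by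
    intro w hw
    have : ∃ x, r y x ∧ resC t x = w := by
      by_contra hno
      push Not at hno
      apply hw
      have k1 : ¬ r y (ext0 t y w) := fun k => hno _ k (resC_ext0 t y w)
      have k2 : ¬ r y (ext0 t y w + h) := fun k => hno _ k (by
        funext j
        simp [resC, ext0, hht j j.2])
      simp [δ, Y, k1, k2]
    obtain ⟨x, hx, rfl⟩ := this
    obtain ⟨u, rfl⟩ := C.assoc hx
    exact ⟨resU t u, rfl⟩
  have hδ := lemF (q := fun j : {j // j ∈ t} => q j) (e := fun j => e j)
    (fun j => C.he j) (fun j => C.hodd j) (C.MC t) (C.MC_triv i₀ hmax t (by simp [ht])) δ (by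
      intro w w' hw hw'
      obtain ⟨u, hu⟩ := hs0 w hw
      obtain ⟨u', hu'⟩ := hs0 w' hw'
      refine ⟨u' * u⁻¹, ?_⟩
      rw [hu', hu, Units.val_mul, mul_assoc, ← mul_assoc (↑u⁻¹ : RS q e t), u.inv_mul, one_mul]) (by
      intro z s
      have e1 : ∀ (Z : RR q e), (∑ u : (RS q e t)ˣ, if u ∈ C.MC t then Y (Z + ext0 t 0 ((u : RS q e t) * (s : RS q e t))) else 0)
          = ∑ x, if r (ext0 t 0 s) x then Y (Z + x) else 0 := by
        intro Z
        refine sum_reindex (r (ext0 t 0 s)) (fun u => u ∈ C.MC t)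
          (fun u : (RS q e t)ˣ => ext0 t 0 ((u : RS q e t) * (s : RS q e t))) ?_ (C.hE t s) (fun x => Y (Z + x))
        intro a b hab
        have := ext0_inj t 0 hab
        exact Units.ext (s.mul_left_inj.1 this)
      have e2 : ∀ u : (RS q e t)ˣ, (if u ∈ C.MC t then δ ((z : RS q e t) + (u : RS q e t) * (s : RS q e t)) else 0) =
          (if u ∈ C.MC t then Y (ext0 t y z + ext0 t 0 ((u : RS q e t) * (s : RS q e t))) else 0) -
          (if u ∈ C.MC t then Y (ext0 t y z + h + ext0 t 0 ((u : RS q e t) * (s : RS q e t))) else 0) := by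
        intro u
        have e3 : ext0 t y ((z : RS q e t) + (u : RS q e t) * (s : RS q e t)) = ext0 t y z + ext0 t 0 ((u : RS q e t) * (s : RS q e t)) := by
          rw [← ext0_add, add_zero]
        split_ifs
        · simp only [δ, e3]
          congr 2; ring
        · simp
      rw [Finset.sum_congr rfl fun u _ => e2 u, Finset.sum_sub_distrib, e1, e1, sub_eq_zero]
      refine C.sr.transl Y hY (ext0 t 0 s) _ _ ?_
      suffices PP r i₀ (ext0 t y z) from this h hh
      refine C.sigma i₀ hei (by rw [ext0_not _ _ _ _ hi₀]; exact hy) ?_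
      obtain ⟨yu, hyu⟩ := hy
      have k1 : IsUnit (ext0 t (Pi.mulSingle i₀ (y i₀)) z : RR q e) := by
        rw [Pi.isUnit_iff]
        intro j
        by_cases hj : j ∈ t
        · rw [ext0_mem _ _ _ _ hj]
          exact Pi.isUnit_iff.1 z.isUnit ⟨j, hj⟩
        · rw [ext0_not _ _ _ _ hj]
          by_cases hji : j = i₀
          · subst hji; simp [← hyu]
          · simp [hji]
      obtain ⟨v, hv⟩ := k1
      have k2 := C.P_mask i₀ (Finset.univ.filter (fun k => q i₀ ≤ q k)) (by simp) (C.P_unit i₀ v h1)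
      convert k2 using 1
      rw [mul_one, hv]
      funext k
      simp only [msk]
      split_ifs with hk
      · by_cases hkt : k ∈ t
        · rw [ext0_mem _ _ _ _ hkt, ext0_mem _ _ _ _ hkt]
        · rw [ext0_not _ _ _ _ hkt, ext0_not _ _ _ _ hkt]
          have : k = i₀ := by
            apply C.hinj
            simp [ht] at hkt hk
            omega
          subst this; simp
      · rfl)
  have h3 := hδ (resC t y)
  have h4 : ext0 t y (resC t y) = y := by
    funext j; simp [ext0, resC]
  simp only [δ, h4, Y] at h3
  rw [if_pos (C.sr.refl y)] at h3
  by_contra hne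
  rw [if_neg hne] at h3
  norm_num at h3

theorem Ctx.partA (C : Ctx q e r) (u : (RR q e)ˣ) (hu : u ∈ C.MM) (huO : u ∈ Om q e) : u = 1 := by
  classical
  by_contra hu1
  obtain ⟨i, hei, hi⟩ := f2 C.he C.hinj C.hodd C.MM u hu hu1 huO
  have hPi : PP r i 1 := by
    intro h hh
    obtain ⟨v, hv, hv1⟩ := hi h hh
    rw [C.mem_MM, hv1] at hv
    exact hv
  obtain ⟨i₀, hi₀, hmax⟩ := Finset.exists_max_image
    (Finset.univ.filter (fun i => 2 ≤ e i ∧ PP r i 1)) q ⟨i, by simp [hei, hPi]⟩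
  simp only [Finset.mem_filter, Finset.mem_univ, true_and] at hi₀ hmax
  have hall := C.P_all i₀ hi₀.1 hi₀.2 (fun j h1 h2 => hmax j ⟨h1, h2⟩)
  let U : AddSubgroup (RR q e) :=
    { carrier := {y | (q i₀ : ZMod (q i₀ ^ e i₀)) ∣ y i₀}
      zero_mem' := dvd_zero _
      add_mem' := fun ha hb => dvd_add ha hb
      neg_mem' := fun ha => (dvd_neg.2 ha) }
  have hmemU : ∀ y, y ∈ U ↔ (q i₀ : ZMod (q i₀ ^ e i₀)) ∣ y i₀ := fun y => Iff.rfl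
  have hne : (Pi.single i₀ ((q i₀ : ZMod (q i₀ ^ e i₀)) ^ (e i₀ - 1)) : RR q e) ≠ 0 := by
    intro h0
    have := congrFun h0 i₀
    rw [Pi.single_eq_same, Pi.zero_apply] at this
    have h2 : ((q i₀ ^ (e i₀ - 1) : ℕ) : ZMod (q i₀ ^ e i₀)) = 0 := by push_cast; exact this
    rw [ZMod.natCast_eq_zero_iff, Nat.pow_dvd_pow_iff_le_right (hq i₀).out.one_lt] at h2
    have := C.he i₀
    omega
  have hmem : (Pi.single i₀ ((q i₀ : ZMod (q i₀ ^ e i₀)) ^ (e i₀ - 1)) : RR q e) ∈ HH q e i₀ := by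
    refine ⟨fun l hl => by simp [hl], ?_⟩
    rw [Pi.single_eq_same, ← pow_succ', show e i₀ - 1 + 1 = e i₀ by have := C.he i₀; omega,
      zm_pow_self]
  refine C.wi U ?_ _ ?_ hne ?_
  · intro htop
    have : (1 : RR q e) ∈ U := htop ▸ AddSubgroup.mem_top _
    rw [hmemU] at this
    exact (zm_isUnit_iff (C.he i₀) 1).1 isUnit_one this
  · rw [hmemU, Pi.single_eq_same]
    exact dvd_pow_self _ (by omega)
  · intro y hy
    refine hall y ((zm_isUnit_iff (C.he i₀) _).2 hy) _ hmem

end A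


section B
variable {ι : Type*} [Fintype ι] [DecidableEq ι] {q e : ι → ℕ} [hq : ∀ i, Fact (q i).Prime]
  {r : RR q e → RR q e → Prop}

theorem Ctx.hE1 (C : Ctx q e r) (s : (RR q e)ˣ) (x : RR q e) :
    r s x ↔ ∃ a, a ∈ C.MM ∧ x = (a : RR q e) * (s : RR q e) := by
  constructor
  · intro h
    obtain ⟨u, rfl⟩ := C.assoc h
    refine ⟨u, ?_, rfl⟩
    have := C.sr.mult C.hs s⁻¹ h
    rw [s.inv_mul, mul_left_comm, s.inv_mul, mul_one] at this
    exact this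
  · rintro ⟨a, ha, rfl⟩
    have := C.sr.mult C.hs s ha
    rw [mul_one, mul_comm] at this
    exact this

open Classical in
theorem Ctx.PhiCF (C : Ctx q e r) (Y : RR q e → ℂ) (hY : CF r Y) (s : (RR q e)ˣ) :
    CF r (fun Z => ∑ u : (RR q e)ˣ, if u ∈ C.MM then Y (Z + (u : RR q e) * (s : RR q e)) else 0) := by
  have e1 : ∀ (Z : RR q e),
      (∑ u : (RR q e)ˣ, if u ∈ C.MM then Y (Z + (u : RR q e) * (s : RR q e)) else 0)
      = ∑ x, if r s x then Y (Z + x) else 0 := by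
    intro Z
    refine sum_reindex (r s) (fun u => u ∈ C.MM)
      (fun u : (RR q e)ˣ => (u : RR q e) * (s : RR q e)) ?_ (C.hE1 s) (fun x => Y (Z + x))
    intro a b hab
    exact Units.ext (s.mul_left_inj.1 hab)
  simp only [e1]
  exact C.sr.transl Y hY s

theorem Ctx.B2 (C : Ctx q e r) (y : RR q e) (m : (RR q e)ˣ) (hm : m ∈ C.MM) : r y (m * y) := by
  classical
  let Y : RR q e → ℂ := fun x => if r y x then 1 else 0
  have hY : CF r Y := by
    intro a b hab
    have : r y a ↔ r y b := ⟨fun k => C.sr.trans k hab, fun k => C.sr.trans k (C.sr.symm hab)⟩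
    simp only [Y, this]
  let δ : RR q e → ℂ := fun w => Y w - Y (m * w)
  have hs0 : ∀ w, δ w ≠ 0 → ∃ u : (RR q e)ˣ, w = u * y := by
    intro w hw
    by_cases k1 : r y w
    · exact C.assoc k1
    · by_cases k2 : r y (m * w)
      · obtain ⟨u, hu⟩ := C.assoc k2
        refine ⟨m⁻¹ * u, ?_⟩
        rw [Units.val_mul, mul_assoc, ← hu, ← mul_assoc, m.inv_mul, one_mul]
      · exact absurd (by simp [δ, Y, k1, k2]) hw
  have hδ := lemF C.he C.hodd C.MM C.partA δ (by
      intro w w' hw hw'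
      obtain ⟨u, hu⟩ := hs0 w hw
      obtain ⟨u', hu'⟩ := hs0 w' hw'
      refine ⟨u' * u⁻¹, ?_⟩
      rw [hu', hu, Units.val_mul, mul_assoc, ← mul_assoc (↑u⁻¹ : RR q e), u.inv_mul, one_mul]) (by
      intro z s
      have e2 : ∀ u : (RR q e)ˣ, (if u ∈ C.MM then δ ((z : RR q e) + (u : RR q e) * (s : RR q e)) else 0) =
          (if u ∈ C.MM then Y ((z : RR q e) + (u : RR q e) * (s : RR q e)) else 0) -
          (if m * u ∈ C.MM then Y (m * (z : RR q e) + ((m * u : (RR q e)ˣ) : RR q e) * (s : RR q e)) else 0) := by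
        intro u
        rw [C.MM.mul_mem_cancel_left hm]
        split_ifs
        · simp only [δ]
          rw [Units.val_mul, mul_add, mul_assoc]
        · simp
      rw [Finset.sum_congr rfl fun u _ => e2 u, Finset.sum_sub_distrib, sub_eq_zero]
      refine Eq.trans ?_ (Equiv.sum_comp (Equiv.mulLeft m) (fun u : (RR q e)ˣ =>
          if u ∈ C.MM then Y (m * (z : RR q e) + (u : RR q e) * (s : RR q e)) else 0)).symm
      exact C.PhiCF Y hY s _ _ ((C.hE1 z _).2 ⟨m, hm, rfl⟩))
  have h3 := hδ y
  simp only [δ, Y] at h3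
  rw [if_pos (C.sr.refl y)] at h3
  by_contra hne
  rw [if_neg hne] at h3
  norm_num at h3

theorem Ctx.B1 (C : Ctx q e r) (y y' : RR q e) (hyy : r y y') :
    ∃ m : (RR q e)ˣ, m ∈ C.MM ∧ y' = m * y := by
  classical
  let D : RR q e → RR q e → ℂ := fun x w => ∑ u : (RR q e)ˣ, if u ∈ C.MM then
    (if (u : RR q e) * x = w then 1 else 0) else 0
  have hD0 : ∀ x w, D x w ≠ 0 → ∃ u : (RR q e)ˣ, u ∈ C.MM ∧ (u : RR q e) * x = w := by
    intro x w hne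
    obtain ⟨u, _, hu⟩ := Finset.exists_ne_zero_of_sum_ne_zero hne
    by_cases h1 : u ∈ C.MM
    · by_cases h2 : (u : RR q e) * x = w
      · exact ⟨u, h1, h2⟩
      · simp [h2] at hu
    · simp [h1] at hu
  let δ : RR q e → ℂ := fun w => D y w - D y' w
  obtain ⟨v, hv⟩ := C.assoc hyy
  have hs0 : ∀ w, δ w ≠ 0 → ∃ u : (RR q e)ˣ, w = u * y := by
    intro w hw
    by_cases k1 : D y w = 0
    · have k2 : D y' w ≠ 0 := fun k2 => hw (by simp [δ, k1, k2])
      obtain ⟨u, _, hu⟩ := hD0 _ _ k2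
      exact ⟨u * v, by rw [← hu, hv, Units.val_mul, mul_assoc]⟩
    · obtain ⟨u, _, hu⟩ := hD0 _ _ k1
      exact ⟨u, hu.symm⟩
  have hδ := lemF C.he C.hodd C.MM C.partA δ (by
      intro w w' hw hw'
      obtain ⟨u, hu⟩ := hs0 w hw
      obtain ⟨u', hu'⟩ := hs0 w' hw'
      refine ⟨u' * u⁻¹, ?_⟩
      rw [hu', hu, Units.val_mul, mul_assoc, ← mul_assoc (↑u⁻¹ : RR q e), u.inv_mul, one_mul]) (by
      intro z s
      let f : RR q e → ℂ := fun x => ∑ u : (RR q e)ˣ, if u ∈ C.MM then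
        (if (u : RR q e) * x = (z : RR q e) then 1 else 0) else 0
      have hf : CF r f := by
        have hf1 : ∀ x, f x = if r z x then 1 else 0 := by
          intro x
          split_ifs with hx
          · obtain ⟨a, ha, rfl⟩ := (C.hE1 z x).1 hx
            simp only [f]
            rw [Finset.sum_eq_single a⁻¹]
            · rw [if_pos (C.MM.inv_mem ha), ← mul_assoc, a.inv_mul, one_mul, if_pos rfl]
            · intro u _ hu
              split_ifs with h1 h2
              · exfalso
                apply hu
                rw [← mul_assoc] at h2
                have h3 : (u : RR q e) * (a : RR q e) = 1 :=
                  z.mul_left_inj.1 (h2.trans (one_mul _).symm)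
                rw [eq_inv_iff_mul_eq_one]
                exact Units.ext h3
              · rfl
              · rfl
            · simp
          · apply Finset.sum_eq_zero
            intro u _
            split_ifs with h1 h2
            · exfalso
              apply hx
              refine (C.hE1 z x).2 ⟨u⁻¹, C.MM.inv_mem h1, ?_⟩
              rw [← h2, ← mul_assoc, u.inv_mul, one_mul]
            · rfl
            · rfl
        intro a b hab
        have : r z a ↔ r z b := ⟨fun k => C.sr.trans k hab, fun k => C.sr.trans k (C.sr.symm hab)⟩
        simp only [hf1, this]
      have e1 : ∀ x, (∑ a : (RR q e)ˣ, if a ∈ C.MM then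
          D x ((z : RR q e) + (a : RR q e) * (s : RR q e)) else 0) =
          ∑ b : (RR q e)ˣ, if b ∈ C.MM then f (x + (b : RR q e) * ((-s : (RR q e)ˣ) : RR q e)) else 0 := by
        intro x
        have a1 : ∀ a : (RR q e)ˣ, (if a ∈ C.MM then
            D x ((z : RR q e) + (a : RR q e) * (s : RR q e)) else 0) =
            ∑ u : (RR q e)ˣ, if u ∈ C.MM then (if a ∈ C.MM then
            (if (u : RR q e) * x = (z : RR q e) + (a : RR q e) * (s : RR q e) then 1 else 0) else 0) else 0 := by
          intro a
          split_ifs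
          · rfl
          · simp
        have a2 : ∀ b : (RR q e)ˣ, (if b ∈ C.MM then
            f (x + (b : RR q e) * ((-s : (RR q e)ˣ) : RR q e)) else 0) =
            ∑ u : (RR q e)ˣ, if u ∈ C.MM then (if b ∈ C.MM then
            (if (u : RR q e) * (x + (b : RR q e) * ((-s : (RR q e)ˣ) : RR q e)) = (z : RR q e) then 1 else 0)
            else 0) else 0 := by
          intro a
          split_ifs
          · rfl
          · simp
        rw [Finset.sum_congr rfl fun a _ => a1 a, Finset.sum_congr rfl fun a _ => a2 a,
          Finset.sum_comm]
        conv_rhs => rw [Finset.sum_comm]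
        refine Finset.sum_congr rfl fun u _ => ?_
        by_cases hu : u ∈ C.MM
        · rw [← Equiv.sum_comp (Equiv.mulLeft u)]
          refine Finset.sum_congr rfl fun b _ => ?_
          rw [if_pos hu, if_pos hu, Equiv.coe_mulLeft, C.MM.mul_mem_cancel_left hu]
          have a3 : (u : RR q e) * x = (z : RR q e) + ((u * b : (RR q e)ˣ) : RR q e) * (s : RR q e) ↔
              (u : RR q e) * (x + (b : RR q e) * ((-s : (RR q e)ˣ) : RR q e)) = (z : RR q e) := by
            rw [Units.val_mul, Units.val_neg]
            constructor
            · intro k; linear_combination k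
            · intro k; linear_combination k
          simp only [a3]
        · simp [hu]
      have e2 : ∀ a : (RR q e)ˣ, (if a ∈ C.MM then δ ((z : RR q e) + (a : RR q e) * (s : RR q e)) else 0) =
          (if a ∈ C.MM then D y ((z : RR q e) + (a : RR q e) * (s : RR q e)) else 0) -
          (if a ∈ C.MM then D y' ((z : RR q e) + (a : RR q e) * (s : RR q e)) else 0) := by
        intro a
        split_ifs
        · rfl
        · simp
      rw [Finset.sum_congr rfl fun u _ => e2 u, Finset.sum_sub_distrib, sub_eq_zero, e1, e1]
      exact C.PhiCF f hf (-s) _ _ hyy)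
  have h3 := hδ y
  simp only [δ] at h3
  rw [sub_eq_zero] at h3
  have h4 : D y y ≠ 0 := by
    simp only [D]
    have h5 : ∀ u : (RR q e)ˣ, (if u ∈ C.MM then
        (if (u : RR q e) * y = y then (1 : ℂ) else 0) else 0) =
        if (u ∈ C.MM ∧ (u : RR q e) * y = y) then 1 else 0 := by
      intro u; rw [ite_and]
    rw [Finset.sum_congr rfl fun u _ => h5 u, Finset.sum_boole]
    have : 0 < (Finset.univ.filter (fun u : (RR q e)ˣ => u ∈ C.MM ∧ (u : RR q e) * y = y)).card :=
      Finset.card_pos.2 ⟨1, by simp [C.MM.one_mem]⟩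
    exact_mod_cast this.ne'
  rw [h3] at h4
  obtain ⟨u, hu, hu2⟩ := hD0 _ _ h4
  refine ⟨u⁻¹, C.MM.inv_mem hu, ?_⟩
  rw [← hu2, ← mul_assoc, u.inv_mul, one_mul]

theorem Ctx.main (C : Ctx q e r) (y y' : RR q e) :
    r y y' ↔ ∃ m : (RR q e)ˣ, r 1 m ∧ y' = m * y := by
  constructor
  · exact C.B1 y y'
  · rintro ⟨m, hm, rfl⟩
    exact C.B2 y m hm

end B

section transfer
variable {G : Type*} [Group G] {R : Type*} [AddCommGroup R]

/-- The relation on `R` transported from the partition `S` of `G`. -/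
def relS (S : Set (Set G)) (E : Multiplicative R ≃* G) (x y : R) : Prop :=
  ∀ X ∈ S, (E (Multiplicative.ofAdd x) ∈ X ↔ E (Multiplicative.ofAdd y) ∈ X)

theorem class_iff {S : Set (Set G)} (hP : Setoid.IsPartition S) {A : Set G} (hA : A ∈ S)
    {a : G} (ha : a ∈ A) (x : G) : (∀ X ∈ S, (a ∈ X ↔ x ∈ X)) ↔ x ∈ A := by
  constructor
  · intro h
    exact (h A hA).1 ha
  · intro hx X hX
    obtain ⟨B, hB, huB⟩ := hP.2 a
    obtain ⟨B', hB', huB'⟩ := hP.2 x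
    constructor
    · intro h
      have h1 := huB X ⟨hX, h⟩
      have h2 := huB A ⟨hA, ha⟩
      rw [h1, ← h2]; exact hx
    · intro h
      have h1 := huB' X ⟨hX, h⟩
      have h2 := huB' A ⟨hA, hx⟩
      rw [h1, ← h2]; exact ha

theorem relS_sr {S : Set (Set G)} (hS : IsSRing S) (E : Multiplicative R ≃* G) :
    SR (relS S E) := by
  obtain ⟨hP, h1, hinv, hcnt⟩ := hS
  refine ⟨⟨fun x X _ => Iff.rfl, fun h X hX => (h X hX).symm,
    fun h h' X hX => (h X hX).trans (h' X hX)⟩, ?_, ?_, ?_⟩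
  · intro x h
    have := (h _ h1).1 (by simp)
    simpa using this
  · intro x y h X hX
    have := h _ (hinv X hX)
    have key : ∀ z : R, E (Multiplicative.ofAdd z) ∈ (fun x : G => x⁻¹) '' X ↔
        E (Multiplicative.ofAdd (-z)) ∈ X := by
      intro z
      rw [ofAdd_neg, map_inv]
      constructor
      · rintro ⟨w, hw, hw'⟩
        rw [← hw']; simpa using hw
      · intro hz
        exact ⟨_, hz, by simp⟩
    rw [key, key] at this
    exact this
  · intro a b z z' hz
    obtain ⟨A, ⟨hA, haA⟩, -⟩ := hP.2 (E (Multiplicative.ofAdd a))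
    obtain ⟨B, ⟨hB, hbB⟩, -⟩ := hP.2 (E (Multiplicative.ofAdd b))
    obtain ⟨Z, ⟨hZ, hzZ⟩, -⟩ := hP.2 (E (Multiplicative.ofAdd z))
    have hz'Z := (hz Z hZ).1 hzZ
    have key : ∀ w : R, {p : R × R | relS S E a p.1 ∧ relS S E b p.2 ∧ p.1 + p.2 = w}.ncard =
        {p : G × G | p.1 ∈ A ∧ p.2 ∈ B ∧ p.1 * p.2 = E (Multiplicative.ofAdd w)}.ncard := by
      intro w
      have hi : Function.Injective (fun p : R × R =>
          ((E (Multiplicative.ofAdd p.1), E (Multiplicative.ofAdd p.2)) : G × G)) := by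
        rintro ⟨a, b⟩ ⟨c, d⟩ h
        simpa using h
      rw [← Set.ncard_image_of_injective _ hi]
      congr 1
      ext ⟨g, k⟩
      constructor
      · rintro ⟨⟨x, y⟩, ⟨hx, hy, hxy⟩, heq⟩
        simp only [Prod.mk.injEq] at heq
        obtain ⟨rfl, rfl⟩ := heq
        refine ⟨(class_iff hP hA haA _).1 hx, (class_iff hP hB hbB _).1 hy, ?_⟩
        rw [← hxy, ← map_mul]; rfl
      · rintro ⟨hx, hy, hxy⟩
        refine ⟨((E.symm g).toAdd, (E.symm k).toAdd), ⟨?_, ?_, ?_⟩, ?_⟩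
        · refine (class_iff hP hA haA _).2 ?_
          simpa using hx
        · refine (class_iff hP hB hbB _).2 ?_
          simpa using hy
        · have h3 : E.symm (g * k) = Multiplicative.ofAdd w := by
            simp only at hxy
            rw [hxy]; simp
          rw [map_mul] at h3
          exact congrArg Multiplicative.toAdd h3
        · simp
    rw [key, key]
    exact hcnt A hA B hB Z hZ _ hzZ _ hz'Z

open Classical in
/-- Shift by `h` inside `U`, identity outside. -/
noncomputable def shiftU (U : AddSubgroup R) (h : R) (hh : h ∈ U) : Equiv.Perm R where
  toFun x := if x ∈ U then x + h else x
  invFun x := if x ∈ U then x - h else x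
  left_inv x := by
    by_cases hx : x ∈ U
    · simp [hx, U.add_mem hx hh]
    · simp [hx]
  right_inv x := by
    by_cases hx : x ∈ U
    · simp [hx, U.sub_mem hx hh]
    · simp [hx]

theorem shiftU_mem {U : AddSubgroup R} {h : R} (hh : h ∈ U) {x : R} (hx : x ∈ U) :
    shiftU U h hh x = x + h := if_pos hx

theorem shiftU_not_mem {U : AddSubgroup R} {h : R} (hh : h ∈ U) {x : R} (hx : x ∉ U) :
    shiftU U h hh x = x := if_neg hx

theorem relS_wi [Fintype R] (hodd : Odd (Fintype.card R)) {S : Set (Set G)} (hS : IsSRing S)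
    (hN : IsNormalSRing S) (E : Multiplicative R ≃* G) : WI (relS S E) := by
  intro U hU h hh h0 H
  have sr := relS_sr hS E
  have H' : ∀ y, y ∉ U → relS S E y (y - h) := by
    intro y hy
    have h1 : -y ∉ U := fun h => hy (by simpa using U.neg_mem h)
    have := sr.neg _ _ (H _ h1)
    rw [neg_neg] at this
    convert this using 1
    abel
  have key : ∀ x y, relS S E (y - x) (shiftU U h hh y - shiftU U h hh x) := by
    intro x y
    by_cases hx : x ∈ U
    · by_cases hy : y ∈ U
      · rw [shiftU_mem hh hx, shiftU_mem hh hy, add_sub_add_right_eq_sub]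
        exact sr.eqv.refl _
      · rw [shiftU_mem hh hx, shiftU_not_mem hh hy, ← sub_sub]
        apply H'
        intro h'
        exact hy (by simpa using U.add_mem h' hx)
    · by_cases hy : y ∈ U
      · rw [shiftU_not_mem hh hx, shiftU_mem hh hy, add_sub_right_comm]
        apply H
        intro h'
        exact hx (by simpa using U.sub_mem hy h')
      · rw [shiftU_not_mem hh hx, shiftU_not_mem hh hy]
        exact sr.eqv.refl _
  let E' : R ≃ G := Multiplicative.ofAdd.trans E.toEquiv
  have hE' : ∀ x, E' x = E (Multiplicative.ofAdd x) := fun _ => rfl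
  have hE'add : ∀ x y, E' (x + y) = E' x * E' y := by
    intro x y; simp [hE', ofAdd_add]
  have hE'sub : ∀ x y, E' (x - y) = E' x * (E' y)⁻¹ := by
    intro x y; simp [hE', ofAdd_sub, div_eq_mul_inv]
  let f : Equiv.Perm G := (E'.symm.trans (shiftU U h hh)).trans E'
  have hfE : ∀ x, f (E' x) = E' (shiftU U h hh x) := by intro x; simp [f]
  have hf : IsSRingAut S f := by
    intro X hX x y
    obtain ⟨x, rfl⟩ := E'.surjective x
    obtain ⟨y, rfl⟩ := E'.surjective y
    rw [hfE, hfE, ← hE'sub, ← hE'sub]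
    exact key x y X hX
  obtain ⟨γ, hγ⟩ : ∃ γ, γ ∉ U := by
    by_contra hc
    push Not at hc
    exact hU ((AddSubgroup.eq_top_iff' U).2 hc)
  have h2γ : γ + γ ∉ U := by
    intro hc
    obtain ⟨k, hk⟩ := hodd
    have h1 : Fintype.card R • γ = 0 := card_nsmul_eq_zero
    rw [hk, add_nsmul, mul_comm, mul_nsmul, two_nsmul, one_nsmul] at h1
    rw [← nsmul_add] at h1
    apply hγ
    have : γ = -(k • (γ + γ)) := by
      rw [eq_neg_iff_add_eq_zero, add_comm]; exact h1
    rw [this]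
    exact U.neg_mem (U.nsmul_mem hc k)
  obtain ⟨g', hg'⟩ := hN f hf (E' γ)
  obtain ⟨δ, rfl⟩ := E'.surjective g'
  have e1 := hg' (E' 0)
  have e2 := hg' (E' γ)
  rw [← hE'add, hfE, hfE, zero_add, shiftU_not_mem hh hγ, shiftU_mem hh U.zero_mem, ← hE'add] at e1
  rw [← hE'add, hfE, hfE, shiftU_not_mem hh hγ, shiftU_not_mem hh h2γ, ← hE'add] at e2
  have e1 := E'.injective e1
  have e2 := add_left_cancel (E'.injective e2)
  rw [← e2, zero_add] at e1
  exact h0 (by simpa using e1.symm)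

end transfer

theorem exists_mulAut {G : Type*} [Group G] [Fintype G] [IsCyclic G]
    (hodd : Odd (Fintype.card G)) (S : Set (Set G)) (hS : IsSRing S) (hnorm : IsNormalSRing S)
    (x y : G) (hxy : ∀ X ∈ S, (x ∈ X ↔ y ∈ X)) :
    ∃ σ : MulAut G, σ x = y ∧ ∀ z, ∀ X ∈ S, (σ z ∈ X ↔ z ∈ X) := by
  rw [← Nat.card_eq_fintype_card] at hodd
  have hn : Nat.card G ≠ 0 := Nat.card_pos.ne'
  generalize hnn : Nat.card G = n at hodd hn
  let q : n.primeFactors → ℕ := fun i => (i : ℕ)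
  let e : n.primeFactors → ℕ := fun i => n.factorization i
  have hq : ∀ i, Fact (q i).Prime := fun i => ⟨Nat.prime_of_mem_primeFactors i.2⟩
  let T : ZMod n ≃+* RR q e := ZMod.equivPi n hn
  let Z : Multiplicative (ZMod n) ≃* G := hnn ▸ zmodCyclicMulEquiv (G := G) inferInstance
  let E : Multiplicative (RR q e) ≃* G := (AddEquiv.toMultiplicative T.symm.toAddEquiv).trans Z
  have : NeZero n := ⟨hn⟩
  have hcard : Fintype.card (RR q e) = n := by
    rw [← Fintype.card_congr T.toEquiv, ZMod.card]
  have C : Ctx q e (relS S E) := by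
    refine ⟨relS_sr hS E, relS_wi (by rw [hcard]; exact hodd) hS hnorm E, ?_, ?_, ?_, ?_⟩
    · intro z
      refine ⟨(T.symm z).val, ?_⟩
      rw [← map_natCast T, ZMod.natCast_zmod_val, RingEquiv.apply_symm_apply]
    · intro i
      exact Finsupp.mem_support_iff.1 (by rw [Nat.support_factorization]; exact i.2)
    · exact Subtype.val_injective
    · intro i h2
      have := Nat.dvd_of_mem_primeFactors i.2
      have h2' : (i : ℕ) = 2 := h2
      rw [h2'] at this
      exact (Nat.not_even_iff_odd.2 hodd) (even_iff_two_dvd.2 this)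
  have hr : relS S E (E.symm x).toAdd (E.symm y).toAdd := by
    intro X hX
    simpa using hxy X hX
  obtain ⟨m, hm, hmy⟩ := (C.main _ _).1 hr
  let μ : RR q e ≃+ RR q e :=
    { toFun := fun z => m * z
      invFun := fun z => (m⁻¹ : (RR q e)ˣ) * z
      left_inv := fun z => by simp
      right_inv := fun z => by simp
      map_add' := fun a b => mul_add _ _ _ }
  let σ : MulAut G := (E.symm.trans (AddEquiv.toMultiplicative μ)).trans E
  have hσ : ∀ z, σ z = E (Multiplicative.ofAdd (m * (E.symm z).toAdd)) := fun z => rfl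
  refine ⟨σ, ?_, ?_⟩
  · rw [hσ, ← hmy]; simp
  · intro z X hX
    have := (C.main (E.symm z).toAdd (m * (E.symm z).toAdd)).2 ⟨m, hm, rfl⟩ X hX
    rw [hσ, ← this]
    simp

/-- a normal S-ring over a finite cyclic group of odd order is
cyclotomic for a unique subgroup `M ≤ Aut(G)`, and its automorphism group is
the semidirect product of the right translations by `M`. -/
theorem normal_sring_is_cyclotomic {G : Type*} [Group G]
    [Fintype G] [IsCyclic G] (hodd : Odd (Fintype.card G))
    (S : Set (Set G)) (hS : IsSRing S) (hnorm : IsNormalSRing S) :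
    ∃ M : Subgroup (MulAut G),
      (S = {C : Set G | ∃ x : G, C = {y : G | ∃ σ ∈ M, σ x = y}}) ∧
      (∀ f : Equiv.Perm G, IsSRingAut S f ↔
        ∃ σ ∈ M, ∃ g : G, ∀ x : G, f x = σ x * g) ∧
      (∀ M' : Subgroup (MulAut G),
        S = {C : Set G | ∃ x : G, C = {y : G | ∃ σ ∈ M', σ x = y}} → M' = M) := by
  have hex := exists_mulAut hodd S hS hnorm
  have hP := hS.1
  let M : Subgroup (MulAut G) :=
    { carrier := {σ | ∀ z, ∀ X ∈ S, (σ z ∈ X ↔ z ∈ X)}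
      mul_mem' := by
        intro a b ha hb z X hX
        rw [MulAut.mul_apply, ha _ X hX, hb _ X hX]
      one_mem' := fun z X hX => Iff.rfl
      inv_mem' := by
        intro a ha z X hX
        have := ha (a⁻¹ z) X hX
        rw [MulAut.apply_inv_self] at this
        exact this.symm }
  have hM : ∀ σ, σ ∈ M ↔ ∀ z, ∀ X ∈ S, (σ z ∈ X ↔ z ∈ X) := fun σ => Iff.rfl
  have horb : ∀ A ∈ S, ∀ a ∈ A, A = {y : G | ∃ σ ∈ M, σ a = y} := by
    intro A hA a ha
    ext y
    constructor
    · intro hy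
      obtain ⟨σ, h1, h2⟩ := hex a y ((class_iff hP hA ha y).2 hy)
      exact ⟨σ, h2, h1⟩
    · rintro ⟨σ, h, rfl⟩
      exact (h a A hA).2 ha
  refine ⟨M, ?_, ?_, ?_⟩
  · ext A
    constructor
    · intro hA
      obtain ⟨a, ha⟩ : A.Nonempty := by
        rw [Set.nonempty_iff_ne_empty]
        rintro rfl
        exact hP.1 hA
      exact ⟨a, horb A hA a ha⟩
    · rintro ⟨x, rfl⟩
      obtain ⟨A, ⟨hA, hx⟩, -⟩ := hP.2 x
      rw [← horb A hA x hx]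
      exact hA
  · intro f
    constructor
    · intro hf
      have hmul : ∀ x y, f (x * y) = f x * (f 1)⁻¹ * f y := by
        intro x y
        obtain ⟨g', hg'⟩ := hnorm f hf y
        have h1 := hg' 1
        rw [one_mul] at h1
        rw [hg', h1]
        group
      let σ : MulAut G := MulEquiv.mk' (f.trans (Equiv.mulRight (f 1)⁻¹)) (by
        intro x y
        simp only [Equiv.trans_apply, Equiv.coe_mulRight]
        rw [hmul]; group)
      have hσ : ∀ x, σ x = f x * (f 1)⁻¹ := fun x => rfl
      refine ⟨σ, ?_, f 1, ?_⟩
      · intro z X hX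
        have := hf X hX 1 z
        rw [hσ, ← this]; simp
      · intro x
        rw [hσ]; group
    · rintro ⟨σ, hσ, g, hfg⟩ X hX x y
      rw [hfg, hfg, mul_inv_rev, mul_assoc, mul_inv_cancel_left, ← map_inv, ← map_mul]
      exact (hσ _ X hX).symm
  · intro M' hM'
    have hle : M' ≤ M := by
      intro τ hτ z X hX
      rw [hM'] at hX
      obtain ⟨x, rfl⟩ := hX
      constructor
      · rintro ⟨ρ, hρ, h⟩
        refine ⟨τ⁻¹ * ρ, M'.mul_mem (M'.inv_mem hτ) hρ, ?_⟩
        rw [MulAut.mul_apply, h, MulAut.inv_apply_self]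
      · rintro ⟨ρ, hρ, h⟩
        refine ⟨τ * ρ, M'.mul_mem hτ hρ, ?_⟩
        rw [MulAut.mul_apply, h]
    refine le_antisymm hle ?_
    intro σ hσ
    obtain ⟨γ, hγ⟩ := IsCyclic.exists_generator (α := G)
    have hO : {y : G | ∃ τ ∈ M', τ γ = y} ∈ S := by
      rw [hM']; exact ⟨γ, rfl⟩
    obtain ⟨τ, hτ, hτσ⟩ := (hσ γ _ hO).2 ⟨1, M'.one_mem, rfl⟩
    have : σ = τ := by
      ext z
      obtain ⟨k, rfl⟩ := Subgroup.mem_zpowers_iff.1 (hγ z)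
      rw [map_zpow, map_zpow, hτσ]
    rw [this]; exact hτ
end

section
/- A finite connected vertex-transitive simple graph has no cut vertices: if G is a finite connected simple graph on vertex set V such that for all u,v ∈ V there exists a graph automorphism of G mapping u to v, then for every vertex v ∈ V with V ∖ {v} nonempty, the subgraph of G induced on V ∖ {v} is connected. -/
/-- a finite connected vertex-transitive simple graph has no
cut vertices: deleting any single vertex leaves a connected induced subgraph. -/
theorem vertexTransitive_no_cut_vertex {V : Type*} [Fintype V]
    (G : SimpleGraph V) (hconn : G.Connected)
    (htrans : ∀ u v : V, ∃ e : G ≃g G, e u = v)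
    (v : V) (hne : ({v}ᶜ : Set V).Nonempty) :
    (SimpleGraph.induce ({v}ᶜ : Set V) G).Connected := by
  obtain ⟨w, hw⟩ := hne
  haveI : Nontrivial V := ⟨w, v, hw⟩
  obtain ⟨u, hu⟩ := hconn.exists_connected_induce_compl_singleton_of_finite_nontrivial
  obtain ⟨e, he⟩ := htrans u v
  let f : G.induce ({u}ᶜ : Set V) →g G.induce ({v}ᶜ : Set V) :=
    { toFun := fun x => ⟨e x.1, fun h => x.2 (e.injective (h.trans he.symm))⟩
      map_rel' := fun {a b} h => e.map_rel_iff.2 h }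
  refine hu.map f ?_
  rintro ⟨y, hy⟩
  refine ⟨⟨e.symm y, fun h => hy ?_⟩, Subtype.ext (e.apply_symm_apply y)⟩
  have h' : e.symm y = u := h
  have : y = v := by rw [← he, ← h', e.apply_symm_apply]
  exact this
end
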